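/- Let (X,d,m) be a length PI space having the deformation property and suppose inf_{x∈X} m(B_1(x)) > 0. Then for every isoperimetric set E ⊆ X the essential interior E^(1) is a bounded set; in particular every isoperimetric set in X has a bounded representative, i.e. a bounded Borel set differing from it by an m-null set. -/

import Mathlib

open MeasureTheory Metric Set Filter Topology ENNReal Bornology
open scoped symmDiff

noncomputable section

variable {X : Type*}

/-- The slope (pointwise Lipschitz constant) of `f` at `x`, computed within `Ω`.
It vanishes at points that are isolated in `Ω`. -/
def slopeOn [MetricSpace X] (Ω : Set X) (f : X → ℝ) (x : X) : ℝ≥0∞ :=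
  Filter.limsup (fun y => ENNReal.ofReal (|f x - f y| / dist x y)) (𝓝[Ω \ {x}] x)

/-- The slope of `f`. -/
def mSlope [MetricSpace X] (f : X → ℝ) (x : X) : ℝ≥0∞ := slopeOn Set.univ f x

/-- `f` is locally Lipschitz on `Ω`. -/
def LocLipOn [MetricSpace X] (Ω : Set X) (f : X → ℝ) : Prop :=
  ∀ x ∈ Ω, ∃ r > (0:ℝ), ∃ K : NNReal, LipschitzOnWith K f (Metric.ball x r ∩ Ω)

/-- Convergence `fn → f` in `L¹_loc(Ω)` w.r.t. the measure `m`. -/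
def TendstoL1loc [MetricSpace X] [MeasurableSpace X] (m : Measure X) (Ω : Set X)
    (fn : ℕ → X → ℝ) (f : X → ℝ) : Prop :=
  ∀ K : Set X, K ⊆ Ω → IsCompact K →
    Tendsto (fun n => ∫⁻ x in K, ENNReal.ofReal |fn n x - f x| ∂m) atTop (𝓝 0)

/-- The total variation `|Df|(B)` of `f : X → ℝ` on the set `B`. -/
def totVar [MetricSpace X] [MeasurableSpace X] (m : Measure X) (f : X → ℝ) (B : Set X) : ℝ≥0∞ :=
  ⨅ (Ω : Set X) (_ : IsOpen Ω) (_ : B ⊆ Ω),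
    ⨅ (fn : ℕ → X → ℝ) (_ : ∀ n, LocLipOn Ω (fn n)) (_ : TendstoL1loc m Ω fn f),
      Filter.liminf (fun n => ∫⁻ x in Ω, slopeOn Ω (fn n) x ∂m) atTop

/-- The perimeter `P(E, B)` of a set `E` in `B`. -/
def Per [MetricSpace X] [MeasurableSpace X] (m : Measure X) (E B : Set X) : ℝ≥0∞ :=
  totVar m (Set.indicator E fun _ => (1:ℝ)) B

/-- `E` has locally finite perimeter. -/
def HasLocFinPer [MetricSpace X] [MeasurableSpace X] (m : Measure X) (E : Set X) : Prop :=
  ∀ x : X, ∃ r > (0:ℝ), Per m E (Metric.ball x r) < ∞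

/-- `E` has finite perimeter. -/
def HasFinPer [MetricSpace X] [MeasurableSpace X] (m : Measure X) (E : Set X) : Prop :=
  Per m E Set.univ < ∞

/-- `m` is finite on bounded sets. -/
def BoundedlyFinite [MetricSpace X] [MeasurableSpace X] (m : Measure X) : Prop :=
  ∀ B : Set X, Bornology.IsBounded B → m B < ∞

/-- Uniformly locally doubling with doubling function `C_D`. -/
def UnifLocDoublingWith [MetricSpace X] [MeasurableSpace X] (C_D : ℝ → ℝ) (m : Measure X) : Prop :=
  ∀ R : ℝ, 0 < R → ∀ x : X, ∀ r : ℝ, 0 < r → r < R →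
    m (Metric.ball x (2 * r)) ≤ ENNReal.ofReal (C_D R) * m (Metric.ball x r)

/-- Weak local (1,1)-Poincaré inequality with dilation `lam` and constant function `C_P`. -/
def WeakPoincareWith [MetricSpace X] [MeasurableSpace X] (lam : ℝ) (C_P : ℝ → ℝ)
    (m : Measure X) : Prop :=
  ∀ f : X → ℝ, LocLipOn Set.univ f → ∀ R : ℝ, 0 < R → ∀ x : X, ∀ r : ℝ, 0 < r → r < R →
    (∫⁻ y in Metric.ball x r,
        ENNReal.ofReal |f y - ⨍ z in Metric.ball x r, f z ∂m| ∂m) / m (Metric.ball x r)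
      ≤ ENNReal.ofReal (C_P R * r) *
          ((∫⁻ y in Metric.ball x (lam * r), mSlope f y ∂m) / m (Metric.ball x (lam * r)))

/-- `(X, d, m)` is a PI space. -/
def IsPIspace [MetricSpace X] [MeasurableSpace X] (m : Measure X) : Prop :=
  (∃ C_D : ℝ → ℝ, (∀ R, 0 < R → 0 < C_D R) ∧ UnifLocDoublingWith C_D m) ∧
  (∃ lam : ℝ, 1 ≤ lam ∧ ∃ C_P : ℝ → ℝ, (∀ R, 0 < R → 0 < C_P R) ∧ WeakPoincareWith lam C_P m)

/-- `(X, d)` is a length space: the distance between two points is the infimum of the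
lengths of continuous curves joining them. -/
def IsLengthSpace (X : Type*) [MetricSpace X] : Prop :=
  ∀ p q : X, ENNReal.ofReal (dist p q) =
    ⨅ (γ : ℝ → X) (_ : ContinuousOn γ (Set.Icc 0 1)) (_ : γ 0 = p) (_ : γ 1 = q),
      eVariationOn γ (Set.Icc 0 1)

/-- Essential interior `E^{(1)}`. -/
def essInt [MetricSpace X] [MeasurableSpace X] (m : Measure X) (E : Set X) : Set X :=
  { x | Tendsto (fun r : ℝ => m (E ∩ Metric.ball x r) / m (Metric.ball x r)) (𝓝[>] 0) (𝓝 1) }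

/-- Essential exterior `E^{(0)}`. -/
def essExt [MetricSpace X] [MeasurableSpace X] (m : Measure X) (E : Set X) : Set X :=
  { x | Tendsto (fun r : ℝ => m (E ∩ Metric.ball x r) / m (Metric.ball x r)) (𝓝[>] 0) (𝓝 0) }

/-- Essential boundary `∂^e E`. -/
def essBdry [MetricSpace X] [MeasurableSpace X] (m : Measure X) (E : Set X) : Set X :=
  (essInt m E ∪ essExt m E)ᶜ

/-- The two deformation inequalities hold for `E` at `x` with radius `R` and constant `C`. -/
def DeformIneq [MetricSpace X] [MeasurableSpace X] (m : Measure X) (E : Set X) (x : X)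
    (R C : ℝ) : Prop :=
  ∀ y ∈ Metric.ball x R, ∀ r ∈ Set.Ioo (0:ℝ) R,
    Per m (E \ Metric.ball y r) (Metric.ball x (2 * R)) ≤
      ENNReal.ofReal C * m (Metric.ball y r ∩ E) / ENNReal.ofReal r +
        Per m E (Metric.ball x (2 * R)) ∧
    Per m (E ∪ Metric.ball y r) (Metric.ball x (2 * R)) ≤
      ENNReal.ofReal C * m (Metric.ball y r \ E) / ENNReal.ofReal r +
        Per m E (Metric.ball x (2 * R))

/-- The deformation inequalities hold for `E` at `x` with radius `R` and some constant. -/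
def DeformAt [MetricSpace X] [MeasurableSpace X] (m : Measure X) (E : Set X) (x : X)
    (R : ℝ) : Prop :=
  0 < R ∧ R ≤ 1 ∧ ∃ C : ℝ, 0 ≤ C ∧ DeformIneq m E x R C

/-- `R_x(E)`: the maximal radius in `(0,1]` for which the deformation inequalities hold. -/
def deformRadius [MetricSpace X] [MeasurableSpace X] (m : Measure X) (E : Set X) (x : X) : ℝ :=
  sSup { R : ℝ | DeformAt m E x R }

/-- `(X, d, m)` has the deformation property. -/
def DeformationProperty [MetricSpace X] [MeasurableSpace X] (m : Measure X) : Prop :=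
  ∀ E : Set X, MeasurableSet E → HasLocFinPer m E → ∀ x : X, ∃ R : ℝ, DeformAt m E x R

/-- `E` is a volume-constrained minimizer of the perimeter. -/
def VolConstMin [MetricSpace X] [MeasurableSpace X] (m : Measure X) (E : Set X) : Prop :=
  MeasurableSet E ∧ HasLocFinPer m E ∧
    ∀ F K : Set X, MeasurableSet F → IsCompact K →
      m ((E ∆ F) \ K) = 0 → m (E ∩ K) = m (F ∩ K) → Per m E K ≤ Per m F K

/-- `E` is an isoperimetric set. -/
def IsIsoperimetricSet [MetricSpace X] [MeasurableSpace X] (m : Measure X) (E : Set X) : Prop :=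
  MeasurableSet E ∧ HasFinPer m E ∧ 0 < m E ∧ m E < ∞ ∧
    ∀ F : Set X, MeasurableSet F → m F = m E → Per m E Set.univ ≤ Per m F Set.univ

/-! ### Slopes -/

theorem nhdsWithin_diff_of_mem_nhds [TopologicalSpace X] {Ω : Set X} {x : X} (h : Ω ∈ 𝓝 x) :
    𝓝[Ω \ {x}] x = 𝓝[≠] x := by
  rw [sdiff_eq, inter_comm]
  exact nhdsWithin_inter_of_mem' (mem_nhdsWithin_of_mem_nhds h)

theorem slopeOn_eq_mSlope [MetricSpace X] {Ω : Set X} (hΩ : IsOpen Ω) (f : X → ℝ) {x : X}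
    (hx : x ∈ Ω) : slopeOn Ω f x = mSlope f x := by
  simp only [mSlope, slopeOn, nhdsWithin_diff_of_mem_nhds (hΩ.mem_nhds hx),
    nhdsWithin_diff_of_mem_nhds univ_mem]

theorem mSlope_eq_limsup [MetricSpace X] (f : X → ℝ) (x : X) :
    mSlope f x = limsup (fun y => ENNReal.ofReal (|f x - f y| / dist x y)) (𝓝[≠] x) := by
  simp only [mSlope, slopeOn, nhdsWithin_diff_of_mem_nhds univ_mem]

theorem ENNReal.limsup_add_le_add_limsup {ι : Type*} (l : Filter ι) (u v : ι → ℝ≥0∞) :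
    limsup (fun i => u i + v i) l ≤ limsup u l + limsup v l := by
  refine le_of_forall_gt fun c hc => ?_
  obtain ⟨a, ha, b, hb, hab⟩ : ∃ a, limsup u l < a ∧ ∃ b, limsup v l < b ∧ a + b < c := by
    have hu : limsup u l ≠ ∞ := fun h => by simp [h] at hc
    have hv : limsup v l ≠ ∞ := fun h => by simp [h] at hc
    obtain ⟨ε, hε, h⟩ := ENNReal.lt_iff_exists_add_pos_lt.1 hc
    have hε2 : ((ε / 2 : NNReal) : ℝ≥0∞) ≠ 0 := by simpa using hε.ne'
    refine ⟨_, ENNReal.lt_add_right hu hε2, _, ENNReal.lt_add_right hv hε2, ?_⟩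
    calc limsup u l + (ε / 2 : NNReal) + (limsup v l + (ε / 2 : NNReal))
        = limsup u l + limsup v l + ((ε / 2 + ε / 2 : NNReal) : ℝ≥0∞) := by
          push_cast; ring
      _ < c := by simpa using h
  refine lt_of_le_of_lt (limsup_le_of_le (by isBoundedDefault) ?_) hab
  filter_upwards [eventually_lt_of_limsup_lt ha, eventually_lt_of_limsup_lt hb] with i h1 h2
  exact add_le_add h1.le h2.le

theorem ENNReal.add_liminf_le_liminf_add {ι : Type*} (l : Filter ι) (u v : ι → ℝ≥0∞) :
    liminf u l + liminf v l ≤ liminf (fun i => u i + v i) l := by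
  rcases l.eq_or_neBot with rfl | hl
  · simp
  refine le_of_forall_lt fun c hc => ?_
  by_cases h0 : liminf u l = 0
  · rw [h0, zero_add] at hc
    refine hc.trans_le (liminf_le_liminf (Eventually.of_forall fun i => le_add_self))
  by_cases h1 : liminf v l = 0
  · rw [h1, add_zero] at hc
    refine hc.trans_le (liminf_le_liminf (Eventually.of_forall fun i => le_self_add))
  obtain ⟨a, ha, b, hb, hab⟩ := ENNReal.exists_lt_add_of_lt_add hc h0 h1
  refine hab.trans_le (le_liminf_of_le (by isBoundedDefault) ?_)
  filter_upwards [eventually_lt_of_lt_liminf ha, eventually_lt_of_lt_liminf hb] with i h1 h2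
  exact add_le_add h1.le h2.le

theorem mSlope_mono [MetricSpace X] {f g : X → ℝ} {x : X}
    (h : ∀ᶠ y in 𝓝 x, |f x - f y| ≤ |g x - g y|) : mSlope f x ≤ mSlope g x := by
  rw [mSlope_eq_limsup, mSlope_eq_limsup]
  refine limsup_le_limsup ?_ (by isBoundedDefault) (by isBoundedDefault)
  filter_upwards [mem_nhdsWithin_of_mem_nhds h] with y hy
  exact ENNReal.ofReal_le_ofReal (div_le_div_of_nonneg_right hy dist_nonneg)

theorem mSlope_congr [MetricSpace X] {f g : X → ℝ} {x : X}
    (h : f =ᶠ[𝓝 x] g) : mSlope f x = mSlope g x := by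
  have hx := h.self_of_nhds
  refine le_antisymm (mSlope_mono ?_) (mSlope_mono ?_) <;>
    filter_upwards [h] with y hy <;> rw [hx, hy]

theorem mSlope_glue [MetricSpace X] {f e η u : X → ℝ} {x : X} {L : ℝ} (hL : 0 ≤ L)
    (h0 : 0 ≤ η x) (h1 : η x ≤ 1) (hη : ∀ y, |η x - η y| ≤ L * dist x y)
    (hu : ∀ᶠ y in 𝓝 x, u y = η y * f y + (1 - η y) * e y)
    (hf : ContinuousAt f x) (he : ContinuousAt e x) :
    mSlope u x ≤ ENNReal.ofReal (η x) * mSlope f x + ENNReal.ofReal (1 - η x) * mSlope e x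
      + ENNReal.ofReal (L * |f x - e x|) := by
  have hux := hu.self_of_nhds
  have hlim : limsup (fun y => ENNReal.ofReal (L * |f y - e y|)) (𝓝[≠] x)
      ≤ ENNReal.ofReal (L * |f x - e x|) := by
    have : Tendsto (fun y => ENNReal.ofReal (L * |f y - e y|)) (𝓝 x)
        (𝓝 (ENNReal.ofReal (L * |f x - e x|))) :=
      ENNReal.tendsto_ofReal (((hf.sub he).abs).const_mul L)
    calc _ ≤ limsup (fun y => ENNReal.ofReal (L * |f y - e y|)) (𝓝 x) :=
          limsup_le_limsup_of_le nhdsWithin_le_nhds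
      _ = _ := this.limsup_eq
  simp only [mSlope_eq_limsup]
  rw [← ENNReal.limsup_const_mul_of_ne_top ENNReal.ofReal_ne_top,
    ← ENNReal.limsup_const_mul_of_ne_top ENNReal.ofReal_ne_top]
  refine le_trans ?_ (add_le_add ((ENNReal.limsup_add_le_add_limsup _ _ _)) hlim)
  refine le_trans ?_ (ENNReal.limsup_add_le_add_limsup _ _ _)
  refine limsup_le_limsup ?_ (by isBoundedDefault) (by isBoundedDefault)
  filter_upwards [mem_nhdsWithin_of_mem_nhds hu, self_mem_nhdsWithin] with y hy hyx
  have hd : 0 < dist x y := dist_pos.2 (Ne.symm hyx)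
  rw [← ENNReal.ofReal_mul h0, ← ENNReal.ofReal_mul (by linarith),
    ← ENNReal.ofReal_add (by positivity) (mul_nonneg (by linarith) (by positivity)),
    ← ENNReal.ofReal_add (add_nonneg (by positivity) (mul_nonneg (by linarith) (by positivity)))
      (by positivity)]
  refine ENNReal.ofReal_le_ofReal ?_
  rw [div_le_iff₀ hd, hux, hy]
  have e1 : η x * f x + (1 - η x) * e x - (η y * f y + (1 - η y) * e y)
      = η x * (f x - f y) + (1 - η x) * (e x - e y) + (η x - η y) * (f y - e y) := by ring
  have e2 : (η x * (|f x - f y| / dist x y) + (1 - η x) * (|e x - e y| / dist x y)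
      + L * |f y - e y|) * dist x y
      = η x * |f x - f y| + (1 - η x) * |e x - e y| + L * dist x y * |f y - e y| := by
    field_simp
  rw [e1, e2]
  refine (abs_add_three _ _ _).trans ?_
  rw [abs_mul, abs_mul, abs_mul, abs_of_nonneg h0, abs_of_nonneg (by linarith : 0 ≤ 1 - η x)]
  gcongr
  exact hη y

theorem measurable_indicator_mSlope [MetricSpace X] [MeasurableSpace X] [BorelSpace X]
    {Ω : Set X} (hΩ : IsOpen Ω) {f : X → ℝ} (hf : ContinuousOn f Ω) :
    Measurable (Ω.indicator (mSlope f)) := by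
  have key : ∀ x, mSlope f x = ⨅ n : ℕ, ⨆ y ∈ ball x (1 / ((n : ℝ) + 1)) ∩ {x}ᶜ,
      ENNReal.ofReal (|f x - f y| / dist x y) := fun x => by
    rw [mSlope_eq_limsup,
      (nhdsWithin_hasBasis (nhds_basis_ball_inv_nat_succ (x := x)) _).limsup_eq_iInf_iSup]
    simp
  have h2 : Ω.indicator (mSlope f) = fun x => ⨅ n : ℕ, Ω.indicator
      (fun x => ⨆ y ∈ ball x (1 / ((n : ℝ) + 1)) ∩ {x}ᶜ,
        ENNReal.ofReal (|f x - f y| / dist x y)) x := by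
    ext x
    by_cases hx : x ∈ Ω
    · simp only [indicator_of_mem hx, key]
    · simp [hx]
  rw [h2]
  refine Measurable.iInf fun n => measurable_of_Ioi fun c => IsOpen.measurableSet ?_
  have h3 : (Ω.indicator (fun x => ⨆ y ∈ ball x (1 / ((n : ℝ) + 1)) ∩ {x}ᶜ,
        ENNReal.ofReal (|f x - f y| / dist x y))) ⁻¹' Ioi c
      = ⋃ y, Ω ∩ (fun x => (dist x y, ENNReal.ofReal (|f x - f y| / dist x y))) ⁻¹'
        (Ioo 0 (1 / ((n : ℝ) + 1)) ×ˢ Ioi c) := by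
    ext x
    by_cases hx : x ∈ Ω
    · simp only [mem_preimage, indicator_of_mem hx, mem_Ioi, lt_iSup_iff, mem_iUnion, mem_inter_iff,
        hx, true_and, mem_prod, mem_Ioo, mem_ball, mem_compl_iff, mem_singleton_iff, exists_prop,
        dist_pos, and_assoc]
      refine exists_congr fun y => ?_
      rw [dist_comm y x, ne_eq, eq_comm (a := x)]
      tauto
    · simp [hx]
  rw [h3]
  refine isOpen_iUnion fun y => ?_
  have h4 : Ω ∩ (fun x => (dist x y, ENNReal.ofReal (|f x - f y| / dist x y))) ⁻¹'
        (Ioo 0 (1 / ((n : ℝ) + 1)) ×ˢ Ioi c)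
      = (Ω \ {y}) ∩ (fun x => (dist x y, ENNReal.ofReal (|f x - f y| / dist x y))) ⁻¹'
        (Ioo 0 (1 / ((n : ℝ) + 1)) ×ˢ Ioi c) := by
    ext x
    simp only [mem_inter_iff, mem_preimage, mem_prod, mem_Ioo, dist_pos, Set.mem_sdiff,
      mem_singleton_iff, mem_Ioi]
    tauto
  rw [h4]
  refine ContinuousOn.isOpen_inter_preimage ?_ (hΩ.sdiff isClosed_singleton)
    (isOpen_Ioo.prod isOpen_Ioi)
  refine ContinuousOn.prodMk (by fun_prop) ?_
  refine ENNReal.continuous_ofReal.comp_continuousOn ?_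
  refine ContinuousOn.div ?_ (by fun_prop) fun x hx => dist_ne_zero.2 hx.2
  exact ((hf.mono sdiff_subset).sub continuousOn_const).abs

/-! ### Locally Lipschitz functions -/

theorem LocLipOn.mono [MetricSpace X] {Ω U : Set X} {f : X → ℝ} (h : LocLipOn Ω f) (hU : U ⊆ Ω) :
    LocLipOn U f := fun x hx => by
  obtain ⟨r, hr, K, hK⟩ := h x (hU hx)
  exact ⟨r, hr, K, hK.mono (inter_subset_inter_right _ hU)⟩

theorem LocLipOn.exists_ball [MetricSpace X] {Ω : Set X} (hΩ : IsOpen Ω) {f : X → ℝ}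
    (h : LocLipOn Ω f) {x : X} (hx : x ∈ Ω) :
    ∃ r > (0 : ℝ), ∃ K : NNReal, LipschitzOnWith K f (ball x r) := by
  obtain ⟨r, hr, K, hK⟩ := h x hx
  obtain ⟨s, hs, hsΩ⟩ := Metric.isOpen_iff.1 hΩ x hx
  refine ⟨min r s, lt_min hr hs, K, hK.mono fun y hy => ⟨ball_subset_ball (min_le_left _ _) hy,
    hsΩ (ball_subset_ball (min_le_right _ _) hy)⟩⟩

theorem LocLipOn.continuousAt [MetricSpace X] {Ω : Set X} (hΩ : IsOpen Ω) {f : X → ℝ}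
    (h : LocLipOn Ω f) {x : X} (hx : x ∈ Ω) : ContinuousAt f x := by
  obtain ⟨r, hr, K, hK⟩ := h.exists_ball hΩ hx
  exact hK.continuousOn.continuousAt (ball_mem_nhds x hr)

theorem LocLipOn.continuousOn [MetricSpace X] {Ω : Set X} (hΩ : IsOpen Ω) {f : X → ℝ}
    (h : LocLipOn Ω f) : ContinuousOn f Ω :=
  fun _ hx => (h.continuousAt hΩ hx).continuousWithinAt

/-- `f` is Lipschitz on some ball around `x`. -/
def LipNear [MetricSpace X] (f : X → ℝ) (x : X) : Prop :=
  ∃ r > (0 : ℝ), ∃ K : NNReal, LipschitzOnWith K f (ball x r)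

theorem LocLipOn.of_lipNear [MetricSpace X] {Ω : Set X} {f : X → ℝ} (h : ∀ x ∈ Ω, LipNear f x) :
    LocLipOn Ω f := fun x hx => by
  obtain ⟨r, hr, K, hK⟩ := h x hx
  exact ⟨r, hr, K, hK.mono inter_subset_left⟩

theorem LipNear.congr [MetricSpace X] {f g : X → ℝ} {x : X} (hf : LipNear f x) (h : f =ᶠ[𝓝 x] g) :
    LipNear g x := by
  obtain ⟨r, hr, K, hK⟩ := hf
  obtain ⟨s, hs, hsg⟩ := Metric.eventually_nhds_iff_ball.1 h
  refine ⟨min r s, lt_min hr hs, K, fun y hy z hz => ?_⟩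
  rw [← hsg y (ball_subset_ball (min_le_right _ _) hy),
    ← hsg z (ball_subset_ball (min_le_right _ _) hz)]
  exact hK (ball_subset_ball (min_le_left _ _) hy) (ball_subset_ball (min_le_left _ _) hz)

theorem LipNear.comp [MetricSpace X] {f : X → ℝ} {x : X} (hf : LipNear f x) {φ : ℝ → ℝ}
    (hφ : LipschitzWith 1 φ) : LipNear (fun y => φ (f y)) x := by
  obtain ⟨r, hr, K, hK⟩ := hf
  exact ⟨r, hr, 1 * K, hφ.comp_lipschitzOnWith hK⟩

theorem LipNear.glue [MetricSpace X] {f e η : X → ℝ} {x : X} (hf : LipNear f x) (he : LipNear e x)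
    {L : NNReal} (hη : LipschitzWith L η) (h0 : ∀ y, 0 ≤ η y) (h1 : ∀ y, η y ≤ 1) :
    LipNear (fun y => η y * f y + (1 - η y) * e y) x := by
  obtain ⟨r, hr, K, hK⟩ := hf
  obtain ⟨s, hs, K', hK'⟩ := he
  set t := min r s with ht
  have ht0 : 0 < t := lt_min hr hs
  set M : ℝ := K * t + K' * t + |f x - e x| with hM
  have hM0 : 0 ≤ M := by positivity
  refine ⟨t, ht0, (K + K' + M.toNNReal * L), LipschitzOnWith.of_dist_le_mul fun y hy z hz => ?_⟩
  have hyr := ball_subset_ball (min_le_left r s) hy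
  have hys := ball_subset_ball (min_le_right r s) hy
  have hzr := ball_subset_ball (min_le_left r s) hz
  have hzs := ball_subset_ball (min_le_right r s) hz
  have a1 := hK.dist_le_mul y hyr z hzr
  have a2 := hK'.dist_le_mul y hys z hzs
  have a3 := hK.dist_le_mul z hzr x (mem_ball_self hr)
  have a4 := hK'.dist_le_mul z hzs x (mem_ball_self hs)
  have a5 := hη.dist_le_mul y z
  rw [Real.dist_eq] at a1 a2 a3 a4 a5 ⊢
  have hzx : dist z x ≤ t := (mem_ball.1 hz).le
  have b1 : |f z - e z| ≤ M := by
    have : f z - e z = (f z - f x) - (e z - e x) + (f x - e x) := by ring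
    rw [this]
    refine (abs_add_le _ _).trans ?_
    have := abs_sub (f z - f x) (e z - e x)
    have c1 : (K : ℝ) * dist z x ≤ K * t := by gcongr
    have c2 : (K' : ℝ) * dist z x ≤ K' * t := by gcongr
    linarith
  have e1 : η y * f y + (1 - η y) * e y - (η z * f z + (1 - η z) * e z)
      = η y * (f y - f z) + (1 - η y) * (e y - e z) + (η y - η z) * (f z - e z) := by ring
  rw [e1]
  refine (abs_add_three _ _ _).trans ?_
  rw [abs_mul, abs_mul, abs_mul, abs_of_nonneg (h0 y), abs_of_nonneg (by linarith [h1 y] : 0 ≤ 1 - η y)]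
  have d1 : η y * |f y - f z| ≤ 1 * (K * dist y z) := by gcongr; exact h1 y
  have d2 : (1 - η y) * |e y - e z| ≤ 1 * (K' * dist y z) := by
    gcongr
    linarith [h0 y]
  have d3 : |η y - η z| * |f z - e z| ≤ (L * dist y z) * M := by gcongr
  push_cast
  rw [Real.coe_toNNReal _ hM0]
  nlinarith

/-! ### Total variation and perimeter on open sets -/

theorem totVar_le_liminf [MetricSpace X] [MeasurableSpace X] [BorelSpace X] {m : Measure X}
    {A : Set X} (hA : IsOpen A) {f : X → ℝ} {fn : ℕ → X → ℝ} (h1 : ∀ n, LocLipOn A (fn n))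
    (h2 : TendstoL1loc m A fn f) :
    totVar m f A ≤ liminf (fun n => ∫⁻ x in A, mSlope (fn n) x ∂m) atTop := by
  have : (fun n => ∫⁻ x in A, mSlope (fn n) x ∂m)
      = fun n => ∫⁻ x in A, slopeOn A (fn n) x ∂m := by
    funext n
    exact setLIntegral_congr_fun hA.measurableSet fun x hx => (slopeOn_eq_mSlope hA _ hx).symm
  rw [this]
  exact iInf_le_of_le A (iInf_le_of_le hA (iInf_le_of_le le_rfl (iInf_le_of_le fn
    (iInf_le_of_le h1 (iInf_le_of_le h2 le_rfl)))))

theorem TendstoL1loc.mono [MetricSpace X] [MeasurableSpace X] {m : Measure X} {U Ω : Set X}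
    {fn : ℕ → X → ℝ} {f : X → ℝ} (h : TendstoL1loc m Ω fn f) (hU : U ⊆ Ω) :
    TendstoL1loc m U fn f := fun K hK hKc => h K (hK.trans hU) hKc

theorem exists_seq_of_totVar_lt [MetricSpace X] [MeasurableSpace X] [BorelSpace X] {m : Measure X}
    {A : Set X} (hA : IsOpen A) {f : X → ℝ} {c : ℝ≥0∞} (h : totVar m f A < c) :
    ∃ fn : ℕ → X → ℝ, (∀ n, LocLipOn A (fn n)) ∧ TendstoL1loc m A fn f ∧
      ∀ n, ∫⁻ x in A, mSlope (fn n) x ∂m < c := by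
  simp only [totVar, iInf_lt_iff] at h
  obtain ⟨Ω, hΩ, hAΩ, fn, h1, h2, h3⟩ := h
  obtain ⟨φ, hφ, hφc⟩ := extraction_of_frequently_atTop (frequently_lt_of_liminf_lt
    (by isBoundedDefault) h3)
  refine ⟨fun n => fn (φ n), fun n => (h1 _).mono hAΩ, fun K hK hKc =>
    (h2 K (hK.trans hAΩ) hKc).comp hφ.tendsto_atTop, fun n => lt_of_le_of_lt ?_ (hφc n)⟩
  rw [setLIntegral_congr_fun hA.measurableSet (fun x hx => (slopeOn_eq_mSlope hΩ _ (hAΩ hx)).symm)]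
  exact lintegral_mono_set hAΩ

theorem abs_indicator_sub_clamp_le (E : Set X) (x : X) (t : ℝ) :
    |max 0 (min t 1) - E.indicator (fun _ => (1 : ℝ)) x|
      ≤ |t - E.indicator (fun _ => (1 : ℝ)) x| := by
  by_cases hx : x ∈ E
  · simp only [indicator_of_mem hx]
    rcases le_total t 1 with h | h
    · rw [min_eq_left h, abs_of_nonpos (by simp [h]), abs_of_nonpos (by linarith)]
      have := le_max_right 0 t
      linarith
    · simp [h]
  · simp only [indicator_of_notMem hx, sub_zero]
    rcases le_total 0 t with h | h
    · rw [max_eq_right (le_min h zero_le_one), abs_of_nonneg (le_min h zero_le_one),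
        abs_of_nonneg h]
      exact min_le_left _ _
    · rw [max_eq_left ((min_le_left _ _).trans h)]
      simp

theorem lipschitzWith_clamp : LipschitzWith 1 fun t : ℝ => max 0 (min t 1) :=
  (LipschitzWith.id.min_const 1).const_max 0

theorem exists_seq_of_per_lt [MetricSpace X] [MeasurableSpace X] [BorelSpace X] {m : Measure X}
    {A : Set X} (hA : IsOpen A) {E : Set X} {c : ℝ≥0∞} (h : Per m E A < c) :
    ∃ fn : ℕ → X → ℝ, (∀ n, LocLipOn A (fn n)) ∧
      TendstoL1loc m A fn (E.indicator fun _ => (1 : ℝ)) ∧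
      (∀ n, ∫⁻ x in A, mSlope (fn n) x ∂m < c) ∧ ∀ n x, 0 ≤ fn n x ∧ fn n x ≤ 1 := by
  obtain ⟨fn, h1, h2, h3⟩ := exists_seq_of_totVar_lt hA h
  refine ⟨fun n x => max 0 (min (fn n x) 1), fun n => ?_, fun K hK hKc => ?_, fun n => ?_,
    fun n x => ⟨le_max_left _ _, max_le zero_le_one (min_le_right _ _)⟩⟩
  · exact LocLipOn.of_lipNear fun x hx => LipNear.comp ((h1 n).exists_ball hA hx)
      lipschitzWith_clamp
  · refine tendsto_of_tendsto_of_tendsto_of_le_of_le tendsto_const_nhds (h2 K hK hKc)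
      (fun _ => zero_le) fun n => ?_
    exact lintegral_mono fun x => ENNReal.ofReal_le_ofReal (abs_indicator_sub_clamp_le E x _)
  · refine lt_of_le_of_lt (lintegral_mono fun x => mSlope_mono (Eventually.of_forall fun y => ?_))
      (h3 n)
    have := lipschitzWith_clamp.dist_le_mul (fn n x) (fn n y)
    simpa [Real.dist_eq] using this

theorem Per_mono [MetricSpace X] [MeasurableSpace X] (m : Measure X) (E : Set X) {A B : Set X}
    (h : A ⊆ B) : Per m E A ≤ Per m E B := by
  simp only [Per, totVar]
  exact iInf_mono fun Ω => iInf_mono fun _ => le_iInf fun hB => iInf_le_of_le (h.trans hB) le_rfl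

theorem TendstoL1loc.congr [MetricSpace X] [MeasurableSpace X] [OpensMeasurableSpace X]
    {m : Measure X} {Ω : Set X}
    {fn : ℕ → X → ℝ} {f g : X → ℝ} (h : TendstoL1loc m Ω fn f) (hfg : ∀ x ∈ Ω, f x = g x) :
    TendstoL1loc m Ω fn g := fun K hK hKc => by
  refine (h K hK hKc).congr fun n => ?_
  exact setLIntegral_congr_fun hKc.isClosed.measurableSet fun x hx => by
    simp only [hfg x (hK hx)]

theorem Per_congr [MetricSpace X] [MeasurableSpace X] [BorelSpace X] (m : Measure X) {E F A : Set X}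
    (hA : IsOpen A) (h : ∀ x ∈ A, x ∈ E ↔ x ∈ F) : Per m E A = Per m F A := by
  have key : ∀ {E F : Set X}, (∀ x ∈ A, x ∈ E ↔ x ∈ F) → Per m F A ≤ Per m E A := by
    intro E F h
    refine le_of_forall_gt fun c hc => ?_
    obtain ⟨c', hc', hcc⟩ := exists_between hc
    obtain ⟨fn, h1, h2, h3⟩ := exists_seq_of_totVar_lt hA hc'
    refine lt_of_le_of_lt (totVar_le_liminf hA h1 (h2.congr fun x hx => ?_)) (lt_of_le_of_lt
      (liminf_le_of_frequently_le' (Frequently.of_forall fun n => (h3 n).le)) hcc)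
    by_cases hE : x ∈ E
    · rw [indicator_of_mem hE, indicator_of_mem ((h x hx).1 hE)]
    · rw [indicator_of_notMem hE, indicator_of_notMem (mt (h x hx).2 hE)]
  exact le_antisymm (key fun x hx => (h x hx).symm) (key h)

theorem Per_compl_le [MetricSpace X] [MeasurableSpace X] [BorelSpace X] (m : Measure X) {E A : Set X}
    (hA : IsOpen A) : Per m Eᶜ A ≤ Per m E A := by
  refine le_of_forall_gt fun c hc => ?_
  obtain ⟨c', hc', hcc⟩ := exists_between hc
  obtain ⟨fn, h1, h2, h3⟩ := exists_seq_of_totVar_lt hA hc'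
  have e0 : ∀ a b : ℝ, |(1 - a) - (1 - b)| = |a - b| := fun a b => by
    rw [← abs_neg]
    congr 1
    ring
  have e1 : ∀ n, mSlope (fun x => 1 - fn n x) = mSlope (fn n) := fun n => by
    funext x
    simp only [mSlope_eq_limsup, e0]
  refine lt_of_le_of_lt (totVar_le_liminf (fn := fun n x => 1 - fn n x) hA (fun n => ?_) fun K hK hKc => ?_)
    (lt_of_le_of_lt
    (liminf_le_of_frequently_le' (Frequently.of_forall fun n => ?_)) hcc)
  · refine LocLipOn.of_lipNear fun x hx => LipNear.comp (φ := fun t => 1 - t)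
      ((h1 n).exists_ball hA hx) ?_
    exact LipschitzWith.of_dist_le_mul fun a b => by rw [Real.dist_eq, Real.dist_eq, e0]; simp
  · refine (h2 K hK hKc).congr fun n => ?_
    refine lintegral_congr fun x => ?_
    by_cases hE : x ∈ E
    · simp [hE, abs_sub_comm]
    · simp [hE]
  · rw [e1]
    exact (h3 n).le

theorem Per_compl [MetricSpace X] [MeasurableSpace X] [BorelSpace X] (m : Measure X) {E A : Set X}
    (hA : IsOpen A) : Per m Eᶜ A = Per m E A := by
  refine le_antisymm (Per_compl_le m hA) ?_
  simpa using Per_compl_le m (E := Eᶜ) hA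

theorem Per_add_le_of_disjoint [MetricSpace X] [MeasurableSpace X] [BorelSpace X] (m : Measure X)
    {E A B U : Set X} (hA : IsOpen A) (hB : IsOpen B) (hU : IsOpen U) (hAU : A ⊆ U) (hBU : B ⊆ U)
    (hAB : Disjoint A B) : Per m E A + Per m E B ≤ Per m E U := by
  refine le_of_forall_gt fun c hc => ?_
  obtain ⟨c', hc', hcc⟩ := exists_between hc
  obtain ⟨fn, h1, h2, h3⟩ := exists_seq_of_totVar_lt hU hc'
  calc Per m E A + Per m E B
      ≤ liminf (fun n => ∫⁻ x in A, mSlope (fn n) x ∂m) atTop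
        + liminf (fun n => ∫⁻ x in B, mSlope (fn n) x ∂m) atTop :=
        add_le_add (totVar_le_liminf hA (fun n => (h1 n).mono hAU) (h2.mono hAU))
          (totVar_le_liminf hB (fun n => (h1 n).mono hBU) (h2.mono hBU))
    _ ≤ _ := ENNReal.add_liminf_le_liminf_add _ _ _
    _ ≤ c' := by
        refine liminf_le_of_frequently_le' (Frequently.of_forall fun n => ?_)
        rw [← lintegral_union hB.measurableSet hAB]
        exact (lintegral_mono_set (union_subset hAU hBU)).trans (h3 n).le
    _ < c := hcc

/-! ### Gluing and cutting along spheres -/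

/-- The radial cutoff that is `1` on the closed ball of radius `a` and `0` off the ball of
radius `b`. -/
def cutoff [MetricSpace X] (o : X) (a b : ℝ) (y : X) : ℝ := max 0 (min ((b - dist y o) / (b - a)) 1)

section Cutoff
variable [MetricSpace X] {o : X} {a b : ℝ}

theorem cutoff_nonneg (y : X) : 0 ≤ cutoff o a b y := le_max_left _ _

theorem cutoff_le_one (y : X) : cutoff o a b y ≤ 1 := max_le zero_le_one (min_le_right _ _)

theorem cutoff_eq_one (hab : a < b) {y : X} (hy : dist y o ≤ a) : cutoff o a b y = 1 := by
  rw [cutoff, min_eq_right, max_eq_right zero_le_one]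
  rw [le_div_iff₀ (by linarith)]
  linarith

theorem cutoff_eq_zero (hab : a < b) {y : X} (hy : b ≤ dist y o) : cutoff o a b y = 0 := by
  rw [cutoff, max_eq_left]
  exact (min_le_left _ _).trans (div_nonpos_of_nonpos_of_nonneg (by linarith) (by linarith))

theorem abs_cutoff_sub_le (hab : a < b) (y z : X) :
    |cutoff o a b y - cutoff o a b z| ≤ 1 / (b - a) * dist y z := by
  have h := lipschitzWith_clamp.dist_le_mul ((b - dist y o) / (b - a)) ((b - dist z o) / (b - a))
  rw [Real.dist_eq, Real.dist_eq, NNReal.coe_one, one_mul, ← sub_div, abs_div,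
    abs_of_pos (by linarith : 0 < b - a)] at h
  refine h.trans ?_
  rw [div_mul_eq_mul_div, one_mul]
  refine div_le_div_of_nonneg_right ?_ (by linarith)
  rw [abs_sub_comm, show b - dist z o - (b - dist y o) = dist y o - dist z o by ring]
  exact abs_dist_sub_le y z o

theorem cutoff_glue (hab : a < b) {f e : X → ℝ} {x : X}
    (hf : dist x o ≤ b → LipNear f x) (he : a ≤ dist x o → LipNear e x) :
    LipNear (fun y => cutoff o a b y * f y + (1 - cutoff o a b y) * e y) x ∧
    mSlope (fun y => cutoff o a b y * f y + (1 - cutoff o a b y) * e y) x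
      ≤ ENNReal.ofReal (cutoff o a b x) * mSlope f x
        + ENNReal.ofReal (1 - cutoff o a b x) * mSlope e x
        + {y | a ≤ dist y o ∧ dist y o ≤ b}.indicator
          (fun y => ENNReal.ofReal (1 / (b - a) * |f y - e y|)) x := by
  have hL : 0 ≤ 1 / (b - a) := by
    have : 0 < b - a := by linarith
    positivity
  rcases lt_or_ge (dist x o) a with hx | hxa
  · have h : f =ᶠ[𝓝 x] fun y => cutoff o a b y * f y + (1 - cutoff o a b y) * e y := by
      filter_upwards [(isOpen_ball (x := o) (ε := a)).mem_nhds (mem_ball.2 hx)] with y hy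
      rw [cutoff_eq_one hab (mem_ball.1 hy).le]
      ring
    refine ⟨(hf (by linarith)).congr h, ?_⟩
    rw [← mSlope_congr h, cutoff_eq_one hab hx.le]
    simp only [ENNReal.ofReal_one, one_mul, add_assoc]
    exact le_self_add
  rcases lt_or_ge b (dist x o) with hx | hxb
  · have h : e =ᶠ[𝓝 x] fun y => cutoff o a b y * f y + (1 - cutoff o a b y) * e y := by
      filter_upwards [(isClosed_closedBall (x := o) (ε := b)).isOpen_compl.mem_nhds
        (fun h => absurd (mem_closedBall.1 h) (not_le.2 hx))] with y hy
      rw [cutoff_eq_zero hab (not_le.1 fun h => hy (mem_closedBall.2 h)).le]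
      ring
    refine ⟨(he (by linarith)).congr h, ?_⟩
    rw [← mSlope_congr h, cutoff_eq_zero hab hx.le]
    simp
  · have hη : LipschitzWith (1 / (b - a)).toNNReal (cutoff o a b) :=
      LipschitzWith.of_dist_le_mul fun y z => by
        rw [Real.coe_toNNReal _ hL, Real.dist_eq]
        exact abs_cutoff_sub_le hab y z
    refine ⟨(hf hxb).glue (he hxa) hη cutoff_nonneg cutoff_le_one, ?_⟩
    rw [indicator_of_mem (show x ∈ {y | a ≤ dist y o ∧ dist y o ≤ b} from ⟨hxa, hxb⟩)]
    obtain ⟨r, hr, K, hK⟩ := hf hxb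
    obtain ⟨r', hr', K', hK'⟩ := he hxa
    exact mSlope_glue hL (cutoff_nonneg x) (cutoff_le_one x) (fun y => abs_cutoff_sub_le hab x y)
      (Eventually.of_forall fun _ => rfl) (hK.continuousOn.continuousAt (ball_mem_nhds x hr))
      (hK'.continuousOn.continuousAt (ball_mem_nhds x hr'))

end Cutoff

theorem aemeasurable_ofReal_abs_sub [MetricSpace X] [MeasurableSpace X] [BorelSpace X]
    {m : Measure X} {C : Set X} (hC : MeasurableSet C) {f g : X → ℝ} (hf : ContinuousOn f C)
    (hg : Measurable g) :
    AEMeasurable (C.indicator fun x => ENNReal.ofReal |f x - g x|) m := by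
  rw [aemeasurable_indicator_iff hC]
  exact ((hf.aemeasurable hC).sub hg.aemeasurable).abs.ennreal_ofReal

theorem isCompact_annulus [MetricSpace X] [ProperSpace X] (o : X) (a b : ℝ) :
    IsCompact {y : X | a ≤ dist y o ∧ dist y o ≤ b} :=
  (isCompact_closedBall o b).of_isClosed_subset
    (IsClosed.inter (isClosed_le continuous_const (continuous_id.dist continuous_const))
      (isClosed_le (continuous_id.dist continuous_const) continuous_const)) fun _ hy => mem_closedBall.2 hy.2

theorem abs_convexCombo_sub_le {t f e c : ℝ} (h0 : 0 ≤ t) (h1 : t ≤ 1) :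
    |t * f + (1 - t) * e - c| ≤ t * |f - c| + (1 - t) * |e - c| := by
  have : t * f + (1 - t) * e - c = t * (f - c) + (1 - t) * (e - c) := by ring
  rw [this]
  refine (abs_add_le _ _).trans ?_
  rw [abs_mul, abs_mul, abs_of_nonneg h0, abs_of_nonneg (by linarith : 0 ≤ 1 - t)]

theorem Per_le_add_of_closedBall_subset [MetricSpace X] [ProperSpace X] [MeasurableSpace X]
    [BorelSpace X] (m : Measure X) {E : Set X} (hE : MeasurableSet E) {U : Set X} (hU : IsOpen U)
    (o : X) {r s : ℝ} (hrs : r < s) (hs : closedBall o s ⊆ U) :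
    Per m E U ≤ Per m E (ball o s) + Per m E (U \ closedBall o r) := by
  have hA : IsOpen (ball o s) := isOpen_ball
  have hB : IsOpen (U \ closedBall o r) := hU.sdiff isClosed_closedBall
  set A := ball o s with hAdef
  set B := U \ closedBall o r with hBdef
  refine le_of_forall_gt fun c hc => ?_
  obtain ⟨c1, hc1, c2, hc2, hcc⟩ := ENNReal.exists_add_lt_of_add_lt hc
  obtain ⟨f, f1, f2, f3, -⟩ := exists_seq_of_per_lt hA hc1
  obtain ⟨e, e1, e2, e3, -⟩ := exists_seq_of_per_lt hB hc2
  set a := (2 * r + s) / 3 with ha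
  set b := (r + 2 * s) / 3 with hb
  have hra : r < a := by rw [ha]; linarith
  have hab : a < b := by rw [ha, hb]; linarith
  have hbs : b < s := by rw [hb]; linarith
  set χ : X → ℝ := E.indicator fun _ => (1 : ℝ) with hχ
  have hχm : Measurable χ := measurable_const.indicator hE
  set T : Set X := {y | a ≤ dist y o ∧ dist y o ≤ b} with hT
  have hTc : IsCompact T := isCompact_annulus o a b
  have hTA : T ⊆ A := fun y hy => mem_ball.2 (hy.2.trans_lt hbs)
  have hTB : T ⊆ B := fun y hy => ⟨hs (mem_closedBall.2 (hy.2.trans hbs.le)),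
    fun h => absurd (mem_closedBall.1 h) (not_le.2 (hra.trans_le hy.1))⟩
  set u : ℕ → X → ℝ := fun n y => cutoff o a b y * f n y + (1 - cutoff o a b y) * e n y with hu
  have hglue : ∀ n, ∀ x ∈ U, _ := fun n x (hx : x ∈ U) => cutoff_glue (o := o) hab (f := f n) (e := e n) (x := x)
    (fun h => (f1 n).exists_ball hA (mem_ball.2 (h.trans_lt hbs)))
    (fun h => (e1 n).exists_ball hB ⟨hx, fun h' => absurd (mem_closedBall.1 h') (not_le.2 (hra.trans_le h))⟩)
  have hlim : TendstoL1loc m U u χ := by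
    intro K hK hKc
    have hK1 : IsCompact (K ∩ closedBall o b) := hKc.inter_right isClosed_closedBall
    have hK2 : IsCompact (K \ ball o a) := hKc.diff isOpen_ball
    have l1 := f2 _ (fun y hy => mem_ball.2 ((mem_closedBall.1 hy.2).trans_lt hbs)) hK1
    have l2 := e2 _ (fun y hy => ⟨hK hy.1, fun h => hy.2 (mem_ball.2
      ((mem_closedBall.1 h).trans_lt hra))⟩) hK2
    have l3 := l1.add l2
    rw [add_zero] at l3
    refine tendsto_of_tendsto_of_tendsto_of_le_of_le tendsto_const_nhds l3
      (fun _ => zero_le) fun n => ?_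
    have hm1 := hK1.isClosed.measurableSet
    have hm2 := hK2.isClosed.measurableSet
    simp only
    rw [← lintegral_indicator hm1, ← lintegral_indicator hm2, ← lintegral_add_left',
      ← lintegral_indicator hKc.isClosed.measurableSet]
    · refine lintegral_mono fun x => ?_
      by_cases hx : x ∈ K
      · have hcv := abs_convexCombo_sub_le (f := f n x) (e := e n x) (c := χ x)
          (cutoff_nonneg (o := o) (a := a) (b := b) x) (cutoff_le_one x)
        have g0 := cutoff_nonneg (o := o) (a := a) (b := b) x
        have g1 := cutoff_le_one (o := o) (a := a) (b := b) x
        rw [indicator_of_mem hx]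
        refine (ENNReal.ofReal_le_ofReal hcv).trans ?_
        rw [ENNReal.ofReal_add (by positivity) (mul_nonneg (by linarith) (abs_nonneg _))]
        refine add_le_add ?_ ?_
        · by_cases hxb : dist x o ≤ b
          · rw [indicator_of_mem (show x ∈ K ∩ closedBall o b from ⟨hx, mem_closedBall.2 hxb⟩)]
            exact ENNReal.ofReal_le_ofReal (mul_le_of_le_one_left (abs_nonneg _) g1)
          · rw [cutoff_eq_zero hab (not_le.1 hxb).le]
            simp
        · by_cases hxa : dist x o < a
          · rw [cutoff_eq_one hab hxa.le]
            simp
          · rw [indicator_of_mem (show x ∈ K \ ball o a from ⟨hx, fun h => hxa (mem_ball.1 h)⟩)]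
            exact ENNReal.ofReal_le_ofReal (mul_le_of_le_one_left (abs_nonneg _) (by linarith))
      · rw [indicator_of_notMem hx]
        exact zero_le
    · exact aemeasurable_ofReal_abs_sub hm1 (((f1 n).continuousOn hA).mono fun y hy =>
        mem_ball.2 ((mem_closedBall.1 hy.2).trans_lt hbs)) hχm
  have hbound : ∀ n, ∫⁻ x in U, mSlope (u n) x ∂m ≤ c1 + c2 + ENNReal.ofReal (1 / (b - a)) *
      (∫⁻ x in T, ENNReal.ofReal |f n x - χ x| ∂m + ∫⁻ x in T, ENNReal.ofReal |e n x - χ x| ∂m) := by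
    intro n
    calc ∫⁻ x in U, mSlope (u n) x ∂m
        = ∫⁻ x, U.indicator (mSlope (u n)) x ∂m := (lintegral_indicator hU.measurableSet _).symm
      _ ≤ ∫⁻ x, (A.indicator (mSlope (f n)) x + (B.indicator (mSlope (e n)) x +
          ENNReal.ofReal (1 / (b - a)) * (T.indicator (fun x => ENNReal.ofReal |f n x - χ x|) x +
            T.indicator (fun x => ENNReal.ofReal |e n x - χ x|) x))) ∂m := by
          refine lintegral_mono fun x => ?_
          by_cases hx : x ∈ U
          · rw [indicator_of_mem hx]
            refine (hglue n x hx).2.trans ?_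
            rw [add_assoc]
            refine add_le_add ?_ (add_le_add ?_ ?_)
            · by_cases hxb : dist x o < b
              · rw [indicator_of_mem (mem_ball.2 (hxb.trans hbs))]
                exact mul_le_of_le_one_left zero_le (by
                  rw [← ENNReal.ofReal_one]; exact ENNReal.ofReal_le_ofReal (cutoff_le_one x))
              · rw [cutoff_eq_zero hab (not_lt.1 hxb)]
                simp
            · by_cases hxa : dist x o ≤ a
              · rw [cutoff_eq_one hab hxa]
                simp
              · rw [indicator_of_mem (show x ∈ B from ⟨hx, fun h => hxa
                  ((mem_closedBall.1 h).trans hra.le)⟩)]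
                exact mul_le_of_le_one_left zero_le (by
                  rw [← ENNReal.ofReal_one]
                  exact ENNReal.ofReal_le_ofReal
                    (by linarith [cutoff_nonneg (o := o) (a := a) (b := b) x]))
            · by_cases hxT : x ∈ T
              · rw [indicator_of_mem hxT, indicator_of_mem hxT, indicator_of_mem hxT,
                  ENNReal.ofReal_mul (by
                    have : 0 < b - a := by linarith
                    positivity), ← ENNReal.ofReal_add (abs_nonneg _) (abs_nonneg _)]
                gcongr
                rw [abs_sub_comm (e n x)]
                exact abs_sub_le _ _ _
              · rw [indicator_of_notMem (show x ∉ {y | a ≤ dist y o ∧ dist y o ≤ b} from hxT)]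
                exact zero_le
          · rw [indicator_of_notMem hx]
            exact zero_le
      _ = ∫⁻ x in A, mSlope (f n) x ∂m + (∫⁻ x in B, mSlope (e n) x ∂m +
          ENNReal.ofReal (1 / (b - a)) * (∫⁻ x in T, ENNReal.ofReal |f n x - χ x| ∂m +
            ∫⁻ x in T, ENNReal.ofReal |e n x - χ x| ∂m)) := by
          have hTm := hTc.isClosed.measurableSet
          rw [lintegral_add_left (measurable_indicator_mSlope hA ((f1 n).continuousOn hA)),
            lintegral_add_left (measurable_indicator_mSlope hB ((e1 n).continuousOn hB)),
            lintegral_const_mul' _ _ ENNReal.ofReal_ne_top,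
            lintegral_add_left' (aemeasurable_ofReal_abs_sub hTm
              (((f1 n).continuousOn hA).mono hTA) hχm),
            lintegral_indicator hA.measurableSet, lintegral_indicator hB.measurableSet,
            lintegral_indicator hTm, lintegral_indicator hTm]
      _ ≤ _ := by
          rw [← add_assoc]
          gcongr
          · exact (f3 n).le
          · exact (e3 n).le
  have herr : Tendsto (fun n => c1 + c2 + ENNReal.ofReal (1 / (b - a)) *
      (∫⁻ x in T, ENNReal.ofReal |f n x - χ x| ∂m + ∫⁻ x in T, ENNReal.ofReal |e n x - χ x| ∂m))
      atTop (𝓝 (c1 + c2 + ENNReal.ofReal (1 / (b - a)) * (0 + 0))) :=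
    tendsto_const_nhds.add (ENNReal.Tendsto.const_mul ((f2 T hTA hTc).add (e2 T hTB hTc))
      (Or.inr ENNReal.ofReal_ne_top))
  rw [add_zero, mul_zero, add_zero] at herr
  calc Per m E U ≤ liminf (fun n => ∫⁻ x in U, mSlope (u n) x ∂m) atTop :=
        totVar_le_liminf hU (fun n => LocLipOn.of_lipNear fun x hx => (hglue n x hx).1) hlim
    _ ≤ _ := liminf_le_liminf (Eventually.of_forall hbound)
    _ = c1 + c2 := herr.liminf_eq
    _ < c := hcc

theorem mSlope_const [MetricSpace X] (c : ℝ) (x : X) : mSlope (fun _ => c) x = 0 := by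
  rw [mSlope_eq_limsup]
  simp only [sub_self, abs_zero, zero_div, ENNReal.ofReal_zero]
  exact limsup_const_bot

theorem abs_mul_sub_indicator_inter_le {E S T : Set X} {x : X} {t s : ℝ} (h0 : 0 ≤ t) (h1 : t ≤ 1)
    (s0 : 0 ≤ s) (s1 : s ≤ 1) (hS : x ∈ S → x ∉ T → t = 1) (hT : x ∉ S → x ∉ T → t = 0) :
    |t * s - (E ∩ S).indicator (fun _ => (1 : ℝ)) x| ≤
      |s - E.indicator (fun _ => (1 : ℝ)) x| + (E ∩ T).indicator (fun _ => (1 : ℝ)) x := by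
  have hts : t * s ≤ s := mul_le_of_le_one_left s0 h1
  have hts0 : 0 ≤ t * s := mul_nonneg h0 s0
  by_cases hxE : x ∈ E
  · by_cases hxT : x ∈ T
    · rw [indicator_of_mem hxE, indicator_of_mem (show x ∈ E ∩ T from ⟨hxE, hxT⟩)]
      have : |t * s - (E ∩ S).indicator (fun _ => (1 : ℝ)) x| ≤ 1 := by
        by_cases hxS : x ∈ S
        · rw [indicator_of_mem (show x ∈ E ∩ S from ⟨hxE, hxS⟩), abs_le]
          constructor <;> linarith
        · rw [indicator_of_notMem (fun h : x ∈ E ∩ S => hxS h.2), abs_le]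
          constructor <;> linarith
      linarith [abs_nonneg (s - 1)]
    · rw [indicator_of_notMem (fun h : x ∈ E ∩ T => hxT h.2), add_zero, indicator_of_mem hxE]
      by_cases hxS : x ∈ S
      · rw [hS hxS hxT, one_mul, indicator_of_mem (show x ∈ E ∩ S from ⟨hxE, hxS⟩)]
      · rw [hT hxS hxT, zero_mul, indicator_of_notMem (fun h : x ∈ E ∩ S => hxS h.2), sub_zero,
          abs_zero]
        exact abs_nonneg _
  · rw [indicator_of_notMem hxE, indicator_of_notMem (fun h : x ∈ E ∩ S => hxE h.1),
      indicator_of_notMem (fun h : x ∈ E ∩ T => hxE h.1), sub_zero, sub_zero, add_zero,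
      abs_of_nonneg hts0, abs_of_nonneg s0]
    exact hts

/-- Cutting a set along a sphere costs at most twice the lower one-sided derivative of the volume
enclosed. -/
theorem Per_inter_add_Per_diff_le [MetricSpace X] [MeasurableSpace X]
    [BorelSpace X] [ProperSpace X] (m : Measure X) [IsFiniteMeasureOnCompacts m] {E : Set X}
    (hE : MeasurableSet E) (o : X)
    (ρ : ℝ) {D : ℝ} (hD : 0 ≤ D) (h : ∃ᶠ h in 𝓝[>] (0 : ℝ),
      m (E ∩ {y | ρ ≤ dist y o ∧ dist y o ≤ ρ + h}) ≤ ENNReal.ofReal (D * h)) :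
    Per m (E ∩ closedBall o ρ) univ + Per m (E \ closedBall o ρ) univ
      ≤ Per m E univ + ENNReal.ofReal (2 * D) := by
  refine le_of_forall_gt fun d hd => ?_
  obtain ⟨c, hc, D', hD', hcd⟩ := ENNReal.exists_add_lt_of_add_lt hd
  refine lt_of_le_of_lt ?_ hcd
  refine le_trans ?_ (add_le_add_right hD'.le c)
  obtain ⟨f, f1, f2, f3, f4⟩ := exists_seq_of_per_lt isOpen_univ hc
  set χ : X → ℝ := E.indicator fun _ => (1 : ℝ) with hχ
  have hχm : Measurable χ := measurable_const.indicator hE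
  have hfc : ∀ n, Continuous (f n) := fun n =>
    continuousOn_univ.1 ((f1 n).continuousOn isOpen_univ)
  let T : ℝ → Set X := fun h => {y | ρ ≤ dist y o ∧ dist y o ≤ ρ + h}
  have hTc : ∀ h, IsCompact (T h) := fun h => isCompact_annulus o ρ (ρ + h)
  have hTm : ∀ h, MeasurableSet (T h) := fun h => (hTc h).isClosed.measurableSet
  have hex : ∀ k : ℕ, ∃ h : ℝ, ∃ n : ℕ, 0 < h ∧ h < 1 / ((k : ℝ) + 1) ∧ k ≤ n ∧
      m (E ∩ T h) ≤ ENNReal.ofReal (D * h) ∧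
      ∫⁻ x in T h, ENNReal.ofReal |f n x - χ x| ∂m ≤ ENNReal.ofReal (h ^ 2) := by
    intro k
    obtain ⟨h, hh, hh1, hh2⟩ := (h.and_eventually (Ioo_mem_nhdsGT
      (show (0 : ℝ) < 1 / ((k : ℝ) + 1) by positivity))).exists
    have := (f2 (T h) (subset_univ _) (hTc h)).eventually_le_const
      (show (0 : ℝ≥0∞) < ENNReal.ofReal (h ^ 2) by
        rw [ENNReal.ofReal_pos]; positivity)
    obtain ⟨n, hn1, hn2⟩ := ((eventually_ge_atTop k).and this).exists
    exact ⟨h, n, hh1, hh2, hn1, hh, hn2⟩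
  choose h n h0 h1 hkn hET hfT using hex
  have hh0 : Tendsto h atTop (𝓝 0) :=
    squeeze_zero (fun k => (h0 k).le) (fun k => (h1 k).le) tendsto_one_div_add_atTop_nhds_zero_nat
  have hn : Tendsto n atTop atTop := tendsto_atTop_mono hkn tendsto_id
  have hET0 : Tendsto (fun k => m (E ∩ T (h k))) atTop (𝓝 0) := by
    have : Tendsto (fun k => ENNReal.ofReal (D * h k)) atTop (𝓝 (ENNReal.ofReal (D * 0))) :=
      ENNReal.tendsto_ofReal (hh0.const_mul D)
    rw [mul_zero, ENNReal.ofReal_zero] at this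
    exact tendsto_of_tendsto_of_tendsto_of_le_of_le tendsto_const_nhds this
      (fun _ => zero_le) hET
  have hconv : ∀ (S : Set X) (η : ℕ → X → ℝ), (∀ k y, 0 ≤ η k y) → (∀ k y, η k y ≤ 1) →
      (∀ k, ∀ y ∈ S, y ∉ T (h k) → η k y = 1) → (∀ k, ∀ y, y ∉ S → y ∉ T (h k) → η k y = 0) →
      TendstoL1loc m univ (fun k y => η k y * f (n k) y)
        ((E ∩ S).indicator fun _ => (1 : ℝ)) := by
    intro S η e0 e1 eS eT K _ hK
    have l := ((f2 K (subset_univ _) hK).comp hn).add hET0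
    rw [add_zero] at l
    refine tendsto_of_tendsto_of_tendsto_of_le_of_le tendsto_const_nhds l
      (fun _ => zero_le) fun k => ?_
    calc ∫⁻ x in K, ENNReal.ofReal |η k x * f (n k) x - (E ∩ S).indicator (fun _ => (1 : ℝ)) x| ∂m
        ≤ ∫⁻ x in K, (ENNReal.ofReal |f (n k) x - χ x| +
            (E ∩ T (h k)).indicator (fun _ => (1 : ℝ≥0∞)) x) ∂m := by
          refine lintegral_mono fun x => ?_
          have := abs_mul_sub_indicator_inter_le (E := E) (e0 k x) (e1 k x) (f4 (n k) x).1
            (f4 (n k) x).2 (eS k x) (eT k x)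
          refine (ENNReal.ofReal_le_ofReal this).trans ?_
          rw [ENNReal.ofReal_add (abs_nonneg _) (indicator_nonneg (fun _ _ => zero_le_one) x)]
          refine add_le_add_right ?_ _
          by_cases hx : x ∈ E ∩ T (h k) <;> simp [hx]
      _ = ∫⁻ x in K, ENNReal.ofReal |f (n k) x - χ x| ∂m +
            ∫⁻ x in K, (E ∩ T (h k)).indicator (fun _ => (1 : ℝ≥0∞)) x ∂m :=
          lintegral_add_right _ (measurable_const.indicator (hE.inter (hTm _)))
      _ ≤ _ := by
          refine add_le_add_right ?_ _
          rw [lintegral_indicator (hE.inter (hTm _)), setLIntegral_one]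
          exact Measure.restrict_apply_le _ _
  set η : ℕ → X → ℝ := fun k => cutoff o ρ (ρ + h k) with hη
  have hab : ∀ k, ρ < ρ + h k := fun k => by linarith [h0 k]
  have hl0 : ∀ x : X, LipNear (fun _ => (0 : ℝ)) x := fun x =>
    ⟨1, one_pos, 0, (LipschitzWith.const 0).lipschitzOnWith⟩
  have hg := fun k x => cutoff_glue (o := o) (hab k) (f := f (n k)) (e := fun _ => 0) (x := x)
    (fun _ => (f1 (n k)).exists_ball isOpen_univ (mem_univ x)) (fun _ => hl0 x)
  have hg' := fun k x => cutoff_glue (o := o) (hab k) (e := f (n k)) (f := fun _ => 0) (x := x)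
    (fun _ => hl0 x) (fun _ => (f1 (n k)).exists_ball isOpen_univ (mem_univ x))
  simp only [mSlope_const, mul_zero, add_zero, zero_add, add_sub_cancel_left, sub_zero, zero_sub,
    abs_neg] at hg hg'
  have hP1 : Per m (E ∩ closedBall o ρ) univ ≤
      liminf (fun k => ∫⁻ x, mSlope (fun y => η k y * f (n k) y) x ∂m) atTop := by
    have := totVar_le_liminf isOpen_univ (fun k => LocLipOn.of_lipNear fun x _ => (hg k x).1)
      (hconv (closedBall o ρ) η (fun k => cutoff_nonneg) (fun k => cutoff_le_one)
        (fun k y hy _ => cutoff_eq_one (hab k) hy) (fun k y hy hyT => cutoff_eq_zero (hab k) ?_))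
    · simpa only [setLIntegral_univ, Per] using this
    · by_contra hlt
      exact hyT ⟨(not_le.1 hy).le, (not_le.1 hlt).le⟩
  have hP2 : Per m (E \ closedBall o ρ) univ ≤
      liminf (fun k => ∫⁻ x, mSlope (fun y => (1 - η k y) * f (n k) y) x ∂m) atTop := by
    have := totVar_le_liminf isOpen_univ (fun k => LocLipOn.of_lipNear fun x _ => (hg' k x).1)
      (hconv (closedBall o ρ)ᶜ (fun k y => 1 - η k y)
        (fun k y => sub_nonneg.2 (cutoff_le_one y)) (fun k y => sub_le_self _ (cutoff_nonneg y))
        (fun k y hy hyT => ?_) (fun k y hy hyT => ?_))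
    · simpa only [setLIntegral_univ, Per, sdiff_eq] using this
    · simp only [hη]
      rw [cutoff_eq_zero (hab k), sub_zero]
      by_contra hlt
      exact hyT ⟨(not_le.1 fun h => hy (mem_closedBall.2 h)).le, (not_le.1 hlt).le⟩
    · simp only [hη]
      rw [cutoff_eq_one (hab k) (mem_closedBall.1 (not_not.1 hy)), sub_self]
  have hsum : ∀ k, ∫⁻ x, mSlope (fun y => η k y * f (n k) y) x ∂m +
      ∫⁻ x, mSlope (fun y => (1 - η k y) * f (n k) y) x ∂m ≤
        c + ENNReal.ofReal (2 * D + 2 * h k) := by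
    intro k
    have hk := h0 k
    set q : X → ℝ≥0∞ := (T (h k)).indicator fun x => ENNReal.ofReal (1 / h k * |f (n k) x|) with hq
    have hqm : Measurable q :=
      ((((hfc (n k)).measurable.abs).const_mul _).ennreal_ofReal).indicator (hTm _)
    have hqi : ∫⁻ x, q x ∂m ≤ ENNReal.ofReal (D + h k) := by
      rw [hq, lintegral_indicator (hTm _)]
      calc ∫⁻ x in T (h k), ENNReal.ofReal (1 / h k * |f (n k) x|) ∂m
          ≤ ∫⁻ x in T (h k), ENNReal.ofReal (1 / h k) * (ENNReal.ofReal |f (n k) x - χ x| +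
              E.indicator (fun _ => (1 : ℝ≥0∞)) x) ∂m := by
            refine lintegral_mono fun x => ?_
            rw [ENNReal.ofReal_mul (by positivity)]
            refine mul_le_mul_right ?_ _
            by_cases hx : x ∈ E
            · rw [indicator_of_mem hx, ← ENNReal.ofReal_one,
                ← ENNReal.ofReal_add (abs_nonneg _) zero_le_one]
              refine ENNReal.ofReal_le_ofReal ?_
              rw [abs_of_nonneg (f4 _ x).1]
              linarith [(f4 (n k) x).2, abs_nonneg (f (n k) x - χ x)]
            · simp [hx, hχ]
        _ = ENNReal.ofReal (1 / h k) * (∫⁻ x in T (h k), ENNReal.ofReal |f (n k) x - χ x| ∂m +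
              m (E ∩ T (h k))) := by
            rw [lintegral_const_mul' _ _ ENNReal.ofReal_ne_top,
              lintegral_add_right _ (measurable_const.indicator hE), lintegral_indicator hE,
              setLIntegral_one, Measure.restrict_apply hE]
        _ ≤ ENNReal.ofReal (1 / h k) * (ENNReal.ofReal (h k ^ 2) + ENNReal.ofReal (D * h k)) := by
            gcongr
            · exact hfT k
            · exact hET k
        _ = ENNReal.ofReal (D + h k) := by
            rw [← ENNReal.ofReal_add (by positivity) (by positivity),
              ← ENNReal.ofReal_mul (by positivity)]
            congr 1
            field_simp
            ring
    calc _ ≤ ∫⁻ x, (mSlope (fun y => η k y * f (n k) y) x +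
          mSlope (fun y => (1 - η k y) * f (n k) y) x) ∂m := le_lintegral_add _ _
      _ ≤ ∫⁻ x, (mSlope (f (n k)) x + 2 * q x) ∂m := by
          refine lintegral_mono fun x => (add_le_add (hg k x).2 (hg' k x).2).trans ?_
          rw [add_add_add_comm, ← add_mul, ← ENNReal.ofReal_add (cutoff_nonneg _)
            (sub_nonneg.2 (cutoff_le_one _)), add_sub_cancel, ENNReal.ofReal_one, one_mul, two_mul]
      _ = ∫⁻ x, mSlope (f (n k)) x ∂m + 2 * ∫⁻ x, q x ∂m := by
          rw [lintegral_add_right _ (hqm.const_mul _), lintegral_const_mul' _ _ (by simp)]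
      _ ≤ c + 2 * ENNReal.ofReal (D + h k) := by
          gcongr
          simpa only [setLIntegral_univ] using (f3 (n k)).le
      _ = _ := by
          rw [← mul_add, ENNReal.ofReal_mul zero_le_two, ENNReal.ofReal_ofNat]
  have hlim : Tendsto (fun k => c + ENNReal.ofReal (2 * D + 2 * h k)) atTop
      (𝓝 (c + ENNReal.ofReal (2 * D + 2 * 0))) :=
    tendsto_const_nhds.add (ENNReal.tendsto_ofReal (tendsto_const_nhds.add (hh0.const_mul 2)))
  rw [mul_zero, add_zero] at hlim
  calc _ ≤ _ := add_le_add hP1 hP2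
    _ ≤ _ := ENNReal.add_liminf_le_liminf_add _ _ _
    _ ≤ _ := liminf_le_liminf (Eventually.of_forall hsum)
    _ = _ := hlim.liminf_eq

/-- A comparison of perimeters in a ball extends to the whole space when the two sets agree near
the boundary of the ball and beyond. -/
theorem Per_univ_le_of_Per_ball_le [MetricSpace X] [ProperSpace X] [MeasurableSpace X]
    [BorelSpace X] (m : Measure X) {E F : Set X} (hE : MeasurableSet E) (hF : MeasurableSet F)
    (hfin : Per m E univ ≠ ∞) {x : X} {a b : ℝ} (hab : a < b) {K : ℝ≥0∞}
    (hFE : ∀ z, a ≤ dist z x → (z ∈ F ↔ z ∈ E))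
    (h : Per m F (ball x b) ≤ K + Per m E (ball x b)) :
    Per m F univ ≤ K + Per m E univ := by
  have hfin' : ∀ U, Per m E U ≠ ∞ := fun U =>
    ne_top_of_le_ne_top hfin (Per_mono m E (subset_univ U))
  set g : ℝ → ℝ := fun t => (Per m E (ball x t)).toReal with hg
  have hgm : Monotone g := fun s t hst =>
    ENNReal.toReal_mono (hfin' _) (Per_mono m E (ball_subset_ball hst))
  obtain ⟨t, ⟨hat, htb⟩, htc⟩ : ∃ t ∈ Ioo a b, ContinuousAt g t := by
    by_contra! hcon
    exact not_le.2 hab (Cardinal.Real.Ioo_countable_iff.1 (hgm.countable_not_continuousAt.mono hcon))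
  refine ENNReal.le_of_forall_pos_le_add fun ε hε _ => ?_
  obtain ⟨δ, hδ, hδg⟩ := Metric.continuousAt_iff.1 htc (ε / 2) (by positivity)
  set δ' := min (δ / 2) (min ((t - a) / 2) ((b - t) / 2)) with hδ'
  have hδ'0 : 0 < δ' := by
    refine lt_min (by positivity) (lt_min ?_ ?_) <;> linarith
  have hd1 : δ' ≤ δ / 2 := min_le_left _ _
  have hd2 : δ' ≤ (t - a) / 2 := (min_le_right _ _).trans (min_le_left _ _)
  have hd3 : δ' ≤ (b - t) / 2 := (min_le_right _ _).trans (min_le_right _ _)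
  have hgε : Per m E (ball x (t + δ')) ≤ Per m E (ball x (t - δ')) + ε := by
    have h1 := hδg (x := t + δ') (by rw [Real.dist_eq, add_sub_cancel_left, abs_of_pos hδ'0]; linarith)
    have h2 := hδg (x := t - δ')
      (by rw [Real.dist_eq, sub_sub_cancel_left, abs_neg, abs_of_pos hδ'0]; linarith)
    rw [Real.dist_eq, abs_lt] at h1 h2
    have h3 : g (t + δ') ≤ g (t - δ') + ε := by linarith [h1.2, h2.1]
    rw [← ENNReal.ofReal_toReal (hfin' (ball x (t + δ'))),
      ← ENNReal.ofReal_toReal (hfin' (ball x (t - δ'))), ← ENNReal.ofReal_coe_nnreal,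
      ← ENNReal.ofReal_add ENNReal.toReal_nonneg ε.coe_nonneg]
    exact ENNReal.ofReal_le_ofReal h3
  have hopen : ∀ s, IsOpen (univ \ closedBall x s) := fun s =>
    isOpen_univ.sdiff isClosed_closedBall
  have hopen' : ∀ s, IsOpen (ball x b \ closedBall x s) := fun s =>
    isOpen_ball.sdiff isClosed_closedBall
  have hq : Per m F (ball x b \ closedBall x t) = Per m E (ball x b \ closedBall x t) :=
    Per_congr m (hopen' t) fun z hz => hFE z
      (hat.le.trans (not_le.1 fun h => hz.2 (mem_closedBall.2 h)).le)
  have hq' : Per m F (univ \ closedBall x (t - δ')) = Per m E (univ \ closedBall x (t - δ')) :=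
    Per_congr m (hopen _) fun z hz => hFE z (le_trans (by linarith)
      (not_le.1 fun h => hz.2 (mem_closedBall.2 h)).le)
  have h1 := Per_le_add_of_closedBall_subset m hF isOpen_univ x (r := t - δ') (s := t)
    (by linarith) (subset_univ _)
  have h2 := Per_add_le_of_disjoint m (E := F) (A := ball x t) (B := ball x b \ closedBall x t)
    isOpen_ball (hopen' t) (isOpen_ball (x := x) (ε := b)) (ball_subset_ball htb.le)
    sdiff_subset (disjoint_sdiff_right.mono_left ball_subset_closedBall)
  have h3 := Per_le_add_of_closedBall_subset m hE isOpen_ball x (r := t) (s := t + δ')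
    (by linarith) (closedBall_subset_ball (by linarith : t + δ' < b))
  have h4 := Per_add_le_of_disjoint m (E := E) (A := ball x (t - δ'))
    (B := univ \ closedBall x (t - δ'))
    isOpen_ball (hopen _) isOpen_univ (subset_univ _) (subset_univ _)
    (disjoint_sdiff_right.mono_left ball_subset_closedBall)
  rw [hq] at h2
  rw [hq'] at h1
  have h5 : Per m F (ball x t) ≤ K + Per m E (ball x (t + δ')) := by
    refine (ENNReal.add_le_add_iff_right (hfin' (ball x b \ closedBall x t))).1 ?_
    calc _ ≤ _ := h2
      _ ≤ _ := h
      _ ≤ _ := add_le_add_right h3 K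
      _ = _ := (add_assoc _ _ _).symm
  calc _ ≤ _ := h1
    _ ≤ K + (Per m E (ball x (t - δ')) + ε) + Per m E (univ \ closedBall x (t - δ')) :=
        add_le_add_left (h5.trans (add_le_add_right hgε K)) _
    _ = K + (Per m E (ball x (t - δ')) + Per m E (univ \ closedBall x (t - δ'))) + ε := by ring
    _ ≤ _ := add_le_add_left (add_le_add_right h4 K) _

theorem Per_union_ball_le [MetricSpace X] [ProperSpace X] [MeasurableSpace X]
    [BorelSpace X] {m : Measure X} {E : Set X} (hE : MeasurableSet E)
    (hfin : Per m E univ ≠ ∞) {x : X} {R C : ℝ} (hdef : DeformIneq m E x R C)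
    {y : X} (hy : y ∈ ball x R) {r : ℝ} (hr : r ∈ Ioo 0 R) :
    Per m (E ∪ ball y r) univ ≤
      ENNReal.ofReal C * m (ball y r \ E) / ENNReal.ofReal r + Per m E univ := by
  refine Per_univ_le_of_Per_ball_le m hE (hE.union measurableSet_ball) hfin (a := r + dist y x)
    (by linarith [hr.2, mem_ball.1 hy] : _ < 2 * R) (fun z hz => ?_) (hdef y hy r hr).2
  have : z ∉ ball y r := fun h => by linarith [mem_ball.1 h, dist_triangle z y x]
  simp [this]

/-! ### Noncollapsed PI spaces -/

/-- A quantitative form of the PI conditions up to a fixed scale. -/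
structure LocalPI [MetricSpace X] [MeasurableSpace X] (m : Measure X) (N k : ℕ) (lam CP : ℝ) :
    Prop where
  one_le_N : 1 ≤ N
  one_le_lam : 1 ≤ lam
  CP_pos : 0 < CP
  lam_lt : 5 * lam < 2 ^ k
  ball_pos : ∀ z : X, ∀ r : ℝ, 0 < r → 0 < m (ball z r)
  ball_lt_top : ∀ z : X, ∀ r : ℝ, m (ball z r) < ∞
  doubling : ∀ z : X, ∀ r : ℝ, 0 < r → r < 2 ^ k → m (ball z (2 * r)) ≤ 2 ^ N * m (ball z r)
  poincare : ∀ f : X → ℝ, LocLipOn univ f → ∀ z : X, ∀ r : ℝ, 0 < r → r < 2 → ∃ c : ℝ,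
    ∫⁻ y in ball z r, ENNReal.ofReal |f y - c| ∂m ≤
      ENNReal.ofReal (CP * r) * ∫⁻ y in ball z (lam * r), mSlope f y ∂m

theorem UnifLocDoublingWith.measure_ball_pos [MetricSpace X] [MeasurableSpace X]
    {m : Measure X} {CD : ℝ → ℝ} (h : UnifLocDoublingWith CD m)
    (hball : 0 < ⨅ x : X, m (ball x 1)) (z : X) {r : ℝ} (hr : 0 < r) : 0 < m (ball z r) := by
  rw [pos_iff_ne_zero]
  intro h0
  have key : ∀ k : ℕ, m (ball z (2 ^ k * r)) = 0 := by
    intro k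
    induction k with
    | zero => simpa using h0
    | succ k ih =>
      have hk : 0 < 2 ^ k * r := by positivity
      have := h (2 ^ k * r + 1) (by positivity) z (2 ^ k * r) hk (by linarith)
      rw [ih, mul_zero, ← mul_assoc, ← pow_succ'] at this
      exact le_antisymm this zero_le
  obtain ⟨k, hk⟩ := pow_unbounded_of_one_lt (1 / r) (one_lt_two)
  have h1 : (1 : ℝ) ≤ 2 ^ k * r := ((div_lt_iff₀ hr).1 hk).le
  have := (hball.trans_le (iInf_le _ z)).trans_le (measure_mono (ball_subset_ball h1))
  exact this.ne' (key k)

theorem exists_localPI [MetricSpace X] [MeasurableSpace X] {m : Measure X}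
    (hbf : BoundedlyFinite m) (hPI : IsPIspace m) (hball : 0 < ⨅ x : X, m (ball x 1)) :
    ∃ (N k : ℕ) (lam CP : ℝ), LocalPI m N k lam CP := by
  obtain ⟨⟨CD, -, hD⟩, lam, hlam, CP, hCP, hP⟩ := hPI
  obtain ⟨k, hk⟩ := pow_unbounded_of_one_lt (5 * lam) (one_lt_two)
  obtain ⟨N, hN⟩ := pow_unbounded_of_one_lt (CD (2 ^ k)) (one_lt_two)
  have hpos := fun (z : X) (r : ℝ) (hr : 0 < r) => hD.measure_ball_pos hball z hr
  have hfin := fun (z : X) (r : ℝ) => hbf (ball z r) isBounded_ball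
  refine ⟨N + 1, k, lam, CP 2, by simp, hlam, hCP 2 two_pos, hk, hpos, hfin, ?_, ?_⟩
  · intro z r hr hrk
    refine (hD _ (by positivity) z r hr hrk).trans (mul_le_mul_left ?_ _)
    calc ENNReal.ofReal (CD (2 ^ k)) ≤ ENNReal.ofReal (2 ^ (N + 1)) :=
          ENNReal.ofReal_le_ofReal (hN.le.trans (pow_le_pow_right₀ one_le_two (by simp)))
      _ = 2 ^ (N + 1) := by
          rw [ENNReal.ofReal_pow zero_le_two, ENNReal.ofReal_ofNat]
  · intro f hf z r hr hr2
    refine ⟨⨍ y in ball z r, f y ∂m, ?_⟩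
    have h := hP f hf 2 two_pos z r hr hr2
    have hb0 := (hpos z r hr).ne'
    have hbl0 := (hpos z (lam * r) (by positivity)).ne'
    rw [ENNReal.div_le_iff hb0 (hfin z r).ne] at h
    refine h.trans ?_
    rw [mul_assoc]
    refine mul_le_mul_right ?_ _
    rw [ENNReal.mul_comm_div]
    refine mul_le_of_le_one_right' ?_
    exact ENNReal.div_le_of_le_mul (by
      rw [one_mul]
      exact measure_mono (ball_subset_ball (le_mul_of_one_le_left hr.le hlam)))

namespace LocalPI
variable [MetricSpace X] [MeasurableSpace X] {m : Measure X} {N k : ℕ} {lam CP : ℝ}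

theorem ball_two_pow_mul_le (h : LocalPI m N k lam CP) (z : X) {r : ℝ} (hr : 0 < r)
    (hr1 : r ≤ 1) {j : ℕ} (hj : j ≤ k) : m (ball z (2 ^ j * r)) ≤ 2 ^ (N * j) * m (ball z r) := by
  induction j with
  | zero => simp
  | succ j ih =>
    have h1 : 2 ^ j * r < 2 ^ k := by
      calc (2 : ℝ) ^ j * r ≤ 2 ^ j * 1 := by gcongr
        _ < 2 ^ k := by
          rw [mul_one]
          exact pow_lt_pow_right₀ one_lt_two (by lia)
    calc m (ball z (2 ^ (j + 1) * r)) = m (ball z (2 * (2 ^ j * r))) := by rw [pow_succ', mul_assoc]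
      _ ≤ 2 ^ N * m (ball z (2 ^ j * r)) := h.doubling z _ (by positivity) h1
      _ ≤ 2 ^ N * (2 ^ (N * j) * m (ball z r)) := by gcongr; exact ih (by lia)
      _ = _ := by rw [← mul_assoc, ← pow_add]; ring_nf

theorem isUnifLocDoublingMeasure (h : LocalPI m N k lam CP) : IsUnifLocDoublingMeasure m := by
  refine ⟨2 ^ N * 2 ^ N, ?_⟩
  filter_upwards [Ioo_mem_nhdsGT (one_half_pos (α := ℝ))] with ε hε x
  have hk : (2 : ℝ) ≤ 2 ^ k := by
    have := h.one_le_lam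
    have := h.lam_lt
    linarith
  calc m (closedBall x (2 * ε)) ≤ m (ball x (2 * (2 * ε))) :=
        measure_mono (closedBall_subset_ball (by linarith [hε.1]))
    _ ≤ 2 ^ N * m (ball x (2 * ε)) := h.doubling x _ (by linarith [hε.1]) (by linarith [hε.2])
    _ ≤ 2 ^ N * (2 ^ N * m (ball x ε)) := by
        gcongr
        exact h.doubling x _ hε.1 (by linarith [hε.2])
    _ ≤ _ := by
        rw [← mul_assoc]
        push_cast
        gcongr
        exact ball_subset_closedBall

theorem isFiniteMeasureOnCompacts (h : LocalPI m N k lam CP) : IsFiniteMeasureOnCompacts m :=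
  ⟨fun K hK => by
    rcases K.eq_empty_or_nonempty with rfl | ⟨z, -⟩
    · simp
    · obtain ⟨r, hr⟩ := hK.isBounded.subset_ball z
      exact (measure_mono hr).trans_lt (h.ball_lt_top z r)⟩

theorem isLocallyFiniteMeasure (h : LocalPI m N k lam CP) : IsLocallyFiniteMeasure m :=
  ⟨fun z => ⟨ball z 1, ball_mem_nhds z one_pos, h.ball_lt_top z 1⟩⟩

theorem exists_le_measure_ball (h : LocalPI m N k lam CP) (hball : 0 < ⨅ x : X, m (ball x 1))
    {ε : ℝ} (hε : 0 < ε) : ∃ δ : ℝ≥0∞, 0 < δ ∧ ∀ z : X, δ ≤ m (ball z ε) := by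
  have key : ∀ j : ℕ, (⨅ x : X, m (ball x 1)) / (2 ^ N) ^ j > 0 ∧
      ∀ z, (⨅ x : X, m (ball x 1)) / (2 ^ N) ^ j ≤ m (ball z (1 / 2 ^ j)) := by
    intro j
    induction j with
    | zero => exact ⟨by simpa using hball, fun z => by simpa using iInf_le _ z⟩
    | succ j ih =>
      refine ⟨ENNReal.div_pos hball.ne' (by finiteness), fun z => ?_⟩
      refine ENNReal.div_le_of_le_mul ?_
      have h2 := h.doubling z (1 / 2 ^ (j + 1)) (by positivity) (by
        calc (1 : ℝ) / 2 ^ (j + 1) < 1 := by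
              rw [div_lt_one (by positivity)]; exact one_lt_pow₀ _root_.one_lt_two j.succ_ne_zero
          _ ≤ 2 ^ k := one_le_pow₀ one_le_two)
      have e : (2 : ℝ) * (1 / 2 ^ (j + 1)) = 1 / 2 ^ j := by field_simp; ring
      rw [e] at h2
      have h3 := (ih.2 z).trans h2
      rw [ENNReal.div_le_iff (by simp : ((2 : ℝ≥0∞) ^ N) ^ j ≠ 0) (by finiteness)] at h3
      calc _ ≤ _ := h3
        _ = _ := by ring
  obtain ⟨j, hj⟩ := pow_unbounded_of_one_lt (1 / ε) (one_lt_two)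
  refine ⟨_, (key j).1, fun z => ((key j).2 z).trans (measure_mono (ball_subset_ball ?_))⟩
  rw [div_le_iff₀ (by positivity)]
  rw [div_lt_iff₀ hε] at hj
  linarith

theorem properSpace [BorelSpace X] [CompleteSpace X] (h : LocalPI m N k lam CP)
    (hball : 0 < ⨅ x : X, m (ball x 1)) : ProperSpace X := by
  refine ⟨fun o R => (TotallyBounded.isCompact_of_isClosed ?_ isClosed_closedBall)⟩
  rw [Metric.totallyBounded_iff]
  intro ε hε
  obtain ⟨δ, hδ, hδz⟩ := h.exists_le_measure_ball hball (ε := ε / 10) (by positivity)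
  obtain ⟨u, hu, hud, huc⟩ := Vitali.exists_disjoint_subfamily_covering_enlargement_closedBall
    (closedBall o R) id (fun _ => ε / 10) (ε / 10) (fun _ _ => le_rfl) 5 (by norm_num)
  refine ⟨u, ?_, fun z hz => ?_⟩
  · have hfin := Measure.finite_const_le_meas_of_disjoint_iUnion m hδ
      (As := fun z : u => closedBall (z : X) (ε / 10)) (fun _ => isClosed_closedBall.measurableSet)
      (fun a b hab => hud a.2 b.2 fun h => hab (Subtype.ext h))
      (ne_top_of_le_ne_top (h.ball_lt_top o (R + ε)).ne (measure_mono (iUnion_subset fun a y hy => ?_)))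
    · have : {i : u | δ ≤ m (closedBall (i : X) (ε / 10))} = univ :=
        eq_univ_of_forall fun i => (hδz i).trans (measure_mono ball_subset_closedBall)
      rw [this, finite_univ_iff] at hfin
      exact toFinite u
    · have := mem_closedBall.1 (hu a.2)
      have := mem_closedBall.1 hy
      rw [mem_ball]
      linarith [dist_triangle y a o]
  · obtain ⟨b, hb, hsub⟩ := huc z hz
    refine mem_iUnion₂.2 ⟨b, hb, ?_⟩
    have := mem_closedBall.1 (hsub (mem_closedBall_self (by positivity)))
    rw [mem_ball]
    simp only [id] at this
    linarith

end LocalPI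

/-! ### Spheres in length spaces and volume growth -/

theorem IsLengthSpace.exists_curve [MetricSpace X] (h : IsLengthSpace X) (p q : X) {ε : ℝ}
    (hε : 0 < ε) : ∃ γ : ℝ → X, ContinuousOn γ (Icc 0 1) ∧ γ 0 = p ∧ γ 1 = q ∧
      eVariationOn γ (Icc 0 1) < ENNReal.ofReal (dist p q + ε) := by
  have h1 : ENNReal.ofReal (dist p q) < ENNReal.ofReal (dist p q + ε) :=
    (ENNReal.ofReal_lt_ofReal_iff (by positivity)).2 (by linarith)
  rw [h p q] at h1
  simp only [iInf_lt_iff] at h1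
  obtain ⟨γ, h2, h3, h4, h5⟩ := h1
  exact ⟨γ, h2, h3, h4, h5⟩

theorem IsLengthSpace.exists_dist_eq [MetricSpace X] (h : IsLengthSpace X) (p q : X) {s ε : ℝ}
    (hs : 0 ≤ s) (hsq : s ≤ dist p q) (hε : 0 < ε) :
    ∃ w, dist w q = s ∧ dist p w + s < dist p q + ε := by
  obtain ⟨γ, hγ, h0, h1, hl⟩ := h.exists_curve p q hε
  have hc : ContinuousOn (fun t => dist (γ t) q) (Icc 0 1) := by fun_prop
  have hivt := intermediate_value_Icc' (zero_le_one (α := ℝ)) hc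
  simp only [h0, h1, dist_self] at hivt
  obtain ⟨t, ht, hts⟩ := hivt ⟨hs, hsq⟩
  replace hts : dist (γ t) q = s := hts
  refine ⟨γ t, hts, ?_⟩
  have e1 : edist p (γ t) ≤ eVariationOn γ (Icc 0 1 ∩ Iic t) := by
    rw [← h0]
    exact eVariationOn.edist_le γ ⟨⟨le_rfl, zero_le_one⟩, ht.1⟩ ⟨ht, le_refl t⟩
  have e2 : edist (γ t) q ≤ eVariationOn γ (Icc 0 1 ∩ Ici t) := by
    rw [← h1]
    exact eVariationOn.edist_le γ ⟨ht, le_refl t⟩ ⟨⟨zero_le_one, le_rfl⟩, ht.2⟩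
  have e3 : eVariationOn γ (Icc 0 1 ∩ Iic t) + eVariationOn γ (Icc 0 1 ∩ Ici t)
      ≤ eVariationOn γ (Icc 0 1) :=
    (eVariationOn.add_le_union γ fun a ha b hb => le_trans ha.2 hb.2).trans
      (eVariationOn.mono γ (union_subset inter_subset_left inter_subset_left))
  have e4 := ((add_le_add e1 e2).trans e3).trans_lt hl
  rw [edist_dist, edist_dist, ← ENNReal.ofReal_add dist_nonneg dist_nonneg,
    ENNReal.ofReal_lt_ofReal_iff (by positivity), hts] at e4
  exact e4

theorem IsLengthSpace.preconnectedSpace [MetricSpace X] (h : IsLengthSpace X) :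
    PreconnectedSpace X := by
  refine ⟨isPreconnected_of_forall_pair fun p _ q _ => ?_⟩
  obtain ⟨γ, hγ, h0, h1, -⟩ := h.exists_curve p q one_pos
  exact ⟨γ '' Icc 0 1, subset_univ _, ⟨0, by simp, h0⟩, ⟨1, by simp, h1⟩,
    isPreconnected_Icc.image γ hγ⟩

theorem IsLengthSpace.measure_sphere_eq_zero [MetricSpace X] [MeasurableSpace X] [BorelSpace X]
    [SecondCountableTopology X] (h : IsLengthSpace X) (m : Measure X) [IsUnifLocDoublingMeasure m]
    [IsLocallyFiniteMeasure m] (x : X) {r : ℝ} (hr : 0 < r) : m (sphere x r) = 0 := by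
  have hae := IsUnifLocDoublingMeasure.ae_tendsto_measure_inter_div m (sphere x r) 2
  have hfalse : ∀ᵐ _ ∂m.restrict (sphere x r), False := by
    filter_upwards [hae, ae_restrict_mem isClosed_sphere.measurableSet] with z hz hzS
    have hδ : Tendsto (fun n : ℕ => r / 2 * (1 / ((n : ℝ) + 1))) atTop (𝓝[>] 0) := by
      refine tendsto_nhdsWithin_iff.2 ⟨?_, Eventually.of_forall fun n => ?_⟩
      · simpa using (tendsto_one_div_add_atTop_nhds_zero_nat (𝕜 := ℝ)).const_mul (r / 2)
      · simp only [mem_Ioi]; positivity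
    have hw : ∀ n : ℕ, ∃ w, dist w z = 2 * (r / 2 * (1 / ((n : ℝ) + 1))) ∧
        dist x w + 2 * (r / 2 * (1 / ((n : ℝ) + 1))) < dist x z + r / 2 * (1 / ((n : ℝ) + 1)) := by
      intro n
      refine h.exists_dist_eq x z (by positivity) ?_ (by positivity)
      rw [dist_comm x z, mem_sphere.1 hzS, ← mul_assoc, mul_div_cancel₀ _ (two_ne_zero)]
      refine mul_le_of_le_one_right hr.le ?_
      rw [div_le_one (by positivity)]
      linarith [(n.cast_nonneg : (0 : ℝ) ≤ n)]
    choose w hw1 hw2 using hw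
    have hlim := hz w _ hδ (Eventually.of_forall fun n => by
      rw [mem_closedBall, dist_comm]; exact (hw1 n).le)
    have : ∀ n : ℕ, sphere x r ∩ closedBall (w n) (r / 2 * (1 / ((n : ℝ) + 1))) = ∅ := by
      intro n
      refine eq_empty_of_forall_notMem fun y hy => ?_
      have h1 := mem_sphere.1 hy.1
      have h2 := mem_closedBall.1 hy.2
      have h3 := hw2 n
      rw [dist_comm x z, mem_sphere.1 hzS] at h3
      linarith [dist_triangle y (w n) x, dist_comm x (w n)]
    simp only [this, measure_empty, ENNReal.zero_div] at hlim
    exact zero_ne_one (tendsto_nhds_unique tendsto_const_nhds hlim)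
  rw [ae_iff] at hfalse
  simpa using hfalse

/-- The volume of the part of `A` inside a ball, as a real number. -/
def ballVol [MetricSpace X] [MeasurableSpace X] (m : Measure X) (A : Set X) (x : X) (s : ℝ) : ℝ :=
  (m (A ∩ ball x s)).toReal

section BallVol
variable [MetricSpace X] [MeasurableSpace X] {m : Measure X} {A : Set X} {x : X}

theorem ballVol_nonneg (s : ℝ) : 0 ≤ ballVol m A x s := ENNReal.toReal_nonneg

theorem ofReal_ballVol (hfin : ∀ s, m (ball x s) < ∞) (s : ℝ) :
    ENNReal.ofReal (ballVol m A x s) = m (A ∩ ball x s) :=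
  ENNReal.ofReal_toReal (ne_top_of_le_ne_top (hfin s).ne (measure_mono inter_subset_right))

theorem ballVol_mono (hfin : ∀ s, m (ball x s) < ∞) : Monotone (ballVol m A x) := fun _ t hst =>
  ENNReal.toReal_mono (ne_top_of_le_ne_top (hfin t).ne (measure_mono inter_subset_right))
    (measure_mono (inter_subset_inter_right _ (ball_subset_ball hst)))

variable [BorelSpace X]

theorem ballVol_continuousAt (hfin : ∀ s, m (ball x s) < ∞) (hA : MeasurableSet A) {s : ℝ}
    (hs : m (sphere x s) = 0) : ContinuousAt (ballVol m A x) s := by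
  have hfs : m (A ∩ ball x s) ≠ ∞ :=
    ne_top_of_le_ne_top (hfin s).ne (measure_mono inter_subset_right)
  refine (ENNReal.tendsto_toReal hfs).comp ?_
  refine tendsto_measure_of_ae_tendsto_indicator (𝓝 s) (hA.inter measurableSet_ball)
    (fun _ => hA.inter measurableSet_ball) (B := ball x (s + 1)) measurableSet_ball (hfin _).ne
    ?_ ?_
  · filter_upwards [Iic_mem_nhds (show s < s + 1 by linarith)] with t ht
    exact inter_subset_right.trans (ball_subset_ball ht)
  · have : ∀ᵐ y ∂m, y ∉ sphere x s := by
      rw [ae_iff]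
      simp only [not_not]
      exact hs
    filter_upwards [this] with y hy
    rcases lt_or_gt_of_ne (fun h => hy (mem_sphere.2 h)) with h | h
    · filter_upwards [Ioi_mem_nhds h] with t ht
      simp only [mem_inter_iff, mem_ball, h, mem_Ioi.1 ht]
    · filter_upwards [Iio_mem_nhds h] with t ht
      simp only [mem_inter_iff, mem_ball, h.not_gt, (mem_Iio.1 ht).not_gt]

theorem measure_inter_annulus_le (hfin : ∀ s, m (ball x s) < ∞) (hA : MeasurableSet A) {r h : ℝ} (hh : 0 ≤ h)
    (hs : m (sphere x (r + h)) = 0) :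
    m (A ∩ {y | r ≤ dist y x ∧ dist y x ≤ r + h}) ≤
      ENNReal.ofReal (ballVol m A x (r + h) - ballVol m A x r) := by
  have hsub : A ∩ {y | r ≤ dist y x ∧ dist y x ≤ r + h} ⊆
      (A ∩ ball x (r + h)) \ (A ∩ ball x r) ∪ sphere x (r + h) := by
    rintro y ⟨hyA, h1, h2⟩
    rcases h2.eq_or_lt with h2 | h2
    · exact Or.inr h2
    · exact Or.inl ⟨⟨hyA, h2⟩, fun h => h1.not_gt h.2⟩
  rw [ENNReal.ofReal_sub _ (ballVol_nonneg r), ofReal_ballVol hfin, ofReal_ballVol hfin]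
  calc _ ≤ _ := measure_mono hsub
    _ ≤ _ := measure_union_le _ _
    _ = m ((A ∩ ball x (r + h)) \ (A ∩ ball x r)) := by rw [hs, add_zero]
    _ = _ := measure_sdiff (inter_subset_inter_right _ (ball_subset_ball (by linarith)))
        (hA.inter measurableSet_ball).nullMeasurableSet
        (ne_top_of_le_ne_top (hfin r).ne (measure_mono inter_subset_right))

end BallVol

/-! ### A local isoperimetric inequality -/

theorem measure_inter_le_lintegral_abs_sub [MeasurableSpace X] {m : Measure X} {A B : Set X}
    (hA : MeasurableSet A) (hB : MeasurableSet B) (hfin : m B ≠ ∞) (h : 2 * m (A ∩ B) ≤ m B)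
    (c : ℝ) :
    m (A ∩ B) ≤ ∫⁻ y in B, ENNReal.ofReal |A.indicator (fun _ => (1 : ℝ)) y - c| ∂m := by
  have h1 : m (A ∩ B) ≤ m (B \ A) := by
    have h2 := measure_inter_add_sdiff B hA (μ := m)
    rw [← h2, inter_comm B A, two_mul] at h
    exact (ENNReal.add_le_add_iff_left (ne_top_of_le_ne_top hfin
      (measure_mono inter_subset_right))).1 h
  rw [← lintegral_inter_add_sdiff _ B hA, inter_comm B A]
  have e1 : ∫⁻ y in A ∩ B, ENNReal.ofReal |A.indicator (fun _ => (1 : ℝ)) y - c| ∂m =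
      ENNReal.ofReal |1 - c| * m (A ∩ B) := by
    rw [← setLIntegral_const]
    exact setLIntegral_congr_fun (hA.inter hB) fun y hy => by rw [indicator_of_mem hy.1]
  have e2 : ∫⁻ y in B \ A, ENNReal.ofReal |A.indicator (fun _ => (1 : ℝ)) y - c| ∂m =
      ENNReal.ofReal |c| * m (B \ A) := by
    rw [← setLIntegral_const]
    exact setLIntegral_congr_fun (hB.diff hA) fun y hy => by
      rw [indicator_of_notMem hy.2, zero_sub, abs_neg]
  rw [e1, e2]
  calc m (A ∩ B) = 1 * m (A ∩ B) := (one_mul _).symm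
    _ ≤ (ENNReal.ofReal |1 - c| + ENNReal.ofReal |c|) * m (A ∩ B) := by
        refine mul_le_mul_left ?_ _
        rw [← ENNReal.ofReal_add (abs_nonneg _) (abs_nonneg _), ← ENNReal.ofReal_one]
        refine ENNReal.ofReal_le_ofReal ?_
        linarith [le_abs_self (1 - c), le_abs_self c]
    _ ≤ _ := by
        rw [add_mul]
        exact add_le_add_right (mul_le_mul_right h1 _) _

namespace LocalPI
variable [MetricSpace X] [MeasurableSpace X] {m : Measure X} {N k : ℕ} {lam CP : ℝ}

theorem measure_inter_ball_le [BorelSpace X] (h : LocalPI m N k lam CP) {A : Set X} (hA : MeasurableSet A)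
    {z : X} {r : ℝ} (hr : 0 < r) (hr2 : r < 2) (hAr : 2 * m (A ∩ ball z r) ≤ m (ball z r))
    {f : X → ℝ} (hf : LocLipOn univ f) :
    m (A ∩ ball z r) ≤
      ∫⁻ y in ball z r, ENNReal.ofReal |f y - A.indicator (fun _ => (1 : ℝ)) y| ∂m +
      ENNReal.ofReal (CP * r) * ∫⁻ y in ball z (lam * r), mSlope f y ∂m := by
  obtain ⟨c, hc⟩ := h.poincare f hf z r hr hr2
  refine (measure_inter_le_lintegral_abs_sub hA measurableSet_ball (h.ball_lt_top z r).ne hAr c).trans ?_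
  refine le_trans ?_ (add_le_add_right hc _)
  have hfm : Measurable f := (continuousOn_univ.1 (hf.continuousOn isOpen_univ)).measurable
  rw [← lintegral_add_right _ ((hfm.sub_const c).abs.ennreal_ofReal)]
  refine lintegral_mono fun y => ?_
  simp only
  rw [← ENNReal.ofReal_add (abs_nonneg _) (abs_nonneg _), abs_sub_comm (f y)]
  exact ENNReal.ofReal_le_ofReal (abs_sub_le _ _ _)

theorem ball_le_two_pow_mul (h : LocalPI m N k lam CP) (z : X) {l : ℝ} (hl : 0 < l)
    (hl1 : l ≤ 1) (i : ℕ) : m (ball z l) ≤ 2 ^ (N * i) * m (ball z (l / 2 ^ i)) := by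
  induction i with
  | zero => simp
  | succ i ih =>
    have h1 : l / 2 ^ (i + 1) < 2 ^ k := by
      calc l / 2 ^ (i + 1) < 1 := by
            rw [div_lt_one (by positivity)]
            exact hl1.trans_lt (one_lt_pow₀ _root_.one_lt_two i.succ_ne_zero)
        _ ≤ 2 ^ k := one_le_pow₀ one_le_two
    have h2 := h.doubling z _ (by positivity) h1
    have e : 2 * (l / 2 ^ (i + 1)) = l / 2 ^ i := by field_simp; ring
    rw [e] at h2
    calc m (ball z l) ≤ _ := ih
      _ ≤ 2 ^ (N * i) * (2 ^ N * m (ball z (l / 2 ^ (i + 1)))) := by gcongr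
      _ = _ := by rw [← mul_assoc, ← pow_add]; ring_nf

/-- Around a density point there is a ball in which the set occupies a controlled proportion. -/
theorem exists_radius (h : LocalPI m N k lam CP) {A : Set X} {l s σ : ℝ} (hl : 0 < l)
    (hl1 : l ≤ 1) (hs : 0 < s) (hσ : 0 < σ) (hAs : m A = ENNReal.ofReal (s ^ N))
    (hsσ : 2 * s ^ N ≤ σ ^ N) {z : X} (hz : ENNReal.ofReal (σ ^ N) ≤ m (ball z l))
    (hd : Tendsto (fun r => m (A ∩ ball z r) / m (ball z r)) (𝓝[>] 0) (𝓝 1)) :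
    ∃ r, 0 < r ∧ r ≤ 1 ∧ r ≤ 4 * l * s / σ ∧ 2 * m (A ∩ ball z r) ≤ m (ball z r) ∧
      m (ball z r) ≤ 2 ^ (N + 1) * m (A ∩ ball z r) := by
  have hex : ∃ j : ℕ, m (ball z (l / 2 ^ j)) < 2 * m (A ∩ ball z (l / 2 ^ j)) := by
    have h1 : Tendsto (fun j : ℕ => l / 2 ^ j) atTop (𝓝[>] 0) := by
      refine tendsto_nhdsWithin_iff.2 ⟨?_, Eventually.of_forall fun n => ?_⟩
      · simpa [div_eq_mul_inv] using (tendsto_pow_atTop_nhds_zero_of_lt_one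
          (r := (1 / 2 : ℝ)) (by norm_num) (by norm_num)).const_mul l
      · simp only [mem_Ioi]; positivity
    obtain ⟨j, hj⟩ := ((hd.comp h1).eventually_const_lt
      (show (2 : ℝ≥0∞)⁻¹ < 1 by simp)).exists
    refine ⟨j, ?_⟩
    simp only [Function.comp] at hj
    have hb : m (ball z (l / 2 ^ j)) ≠ 0 := (h.ball_pos z _ (by positivity)).ne'
    rw [ENNReal.lt_div_iff_mul_lt (Or.inl hb) (Or.inl (h.ball_lt_top z _).ne), mul_comm,
      ← div_eq_mul_inv, ENNReal.div_lt_iff (Or.inl (by simp)) (Or.inl (by simp)), mul_comm] at hj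
    exact hj
  classical
  have hP0 : ¬ m (ball z (l / 2 ^ 0)) < 2 * m (A ∩ ball z (l / 2 ^ 0)) := by
    rw [pow_zero, div_one, not_lt]
    calc 2 * m (A ∩ ball z l) ≤ 2 * m A := by gcongr; exact inter_subset_left
      _ = ENNReal.ofReal (2 * s ^ N) := by
          rw [hAs, ENNReal.ofReal_mul zero_le_two, ENNReal.ofReal_ofNat]
      _ ≤ ENNReal.ofReal (σ ^ N) := ENNReal.ofReal_le_ofReal hsσ
      _ ≤ _ := hz
  obtain ⟨i, hi⟩ := Nat.exists_eq_succ_of_ne_zero (n := Nat.find hex) fun h0 => by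
    have := Nat.find_spec hex
    rw [h0] at this
    exact hP0 this
  have hP1 := Nat.find_spec hex
  have hP2 := Nat.find_min hex (m := i) (by lia)
  rw [hi] at hP1
  rw [not_lt] at hP2
  have hr1 : l / 2 ^ i ≤ 1 := by
    rw [div_le_one (by positivity)]
    exact hl1.trans (one_le_pow₀ one_le_two)
  have hBA : m (ball z (l / 2 ^ i)) ≤ 2 ^ (N + 1) * m (A ∩ ball z (l / 2 ^ i)) := by
    have e : 2 * (l / 2 ^ (i + 1)) = l / 2 ^ i := by field_simp; ring
    have h2 := h.doubling z (l / 2 ^ (i + 1)) (by positivity) (by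
      have : l / 2 ^ (i + 1) ≤ l / 2 ^ i := by rw [← e]; linarith [show 0 < l / 2 ^ (i + 1) by positivity]
      have h3 := h.lam_lt
      have h4 := h.one_le_lam
      linarith)
    rw [e] at h2
    calc _ ≤ _ := h2
      _ ≤ 2 ^ N * (2 * m (A ∩ ball z (l / 2 ^ (i + 1)))) := by gcongr
      _ ≤ 2 ^ N * (2 * m (A ∩ ball z (l / 2 ^ i))) := by
          gcongr
          · exact one_le_two
          · exact i.le_succ
      _ = _ := by rw [pow_succ, mul_assoc]
  refine ⟨l / 2 ^ i, by positivity, hr1, ?_, hP2, hBA⟩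
  have h5 : ENNReal.ofReal (σ ^ N) ≤ ENNReal.ofReal ((2 ^ i * (4 * s)) ^ N) := by
    calc ENNReal.ofReal (σ ^ N) ≤ _ := hz
      _ ≤ 2 ^ (N * i) * m (ball z (l / 2 ^ i)) := h.ball_le_two_pow_mul z hl hl1 i
      _ ≤ 2 ^ (N * i) * (2 ^ (N + 1) * ENNReal.ofReal (s ^ N)) := by
          gcongr
          refine hBA.trans ?_
          gcongr
          rw [← hAs]
          exact measure_mono inter_subset_left
      _ = ENNReal.ofReal (2 ^ (N * i) * (2 ^ (N + 1) * s ^ N)) := by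
          rw [ENNReal.ofReal_mul (by positivity), ENNReal.ofReal_mul (by positivity),
            ENNReal.ofReal_pow zero_le_two, ENNReal.ofReal_pow zero_le_two, ENNReal.ofReal_ofNat]
      _ ≤ _ := by
          refine ENNReal.ofReal_le_ofReal ?_
          rw [mul_pow, mul_pow, ← pow_mul, mul_comm i N]
          gcongr
          rw [show (4 : ℝ) = 2 ^ 2 by norm_num, ← pow_mul]
          exact pow_le_pow_right₀ one_le_two (by linarith [h.one_le_N])
  rw [ENNReal.ofReal_le_ofReal_iff (by positivity)] at h5
  have h6 : σ ≤ 2 ^ i * (4 * s) :=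
    (pow_le_pow_iff_left₀ hσ.le (by positivity) (by linarith [h.one_le_N])).1 h5
  rw [le_div_iff₀ hσ, div_mul_eq_mul_div, div_le_iff₀ (by positivity)]
  calc l * σ ≤ l * (2 ^ i * (4 * s)) := by gcongr
    _ = _ := by ring

end LocalPI

namespace LocalPI
variable [MetricSpace X] [MeasurableSpace X] {m : Measure X} {N k : ℕ} {lam CP : ℝ}

theorem isoperimetric [BorelSpace X] [ProperSpace X] (h : LocalPI m N k lam CP) {A : Set X}
    (hA : MeasurableSet A) (hd : ∀ᵐ z ∂m, z ∈ A →
      Tendsto (fun r => m (A ∩ ball z r) / m (ball z r)) (𝓝[>] 0) (𝓝 1))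
    {l s σ p : ℝ} (hl : 0 < l) (hl1 : l ≤ 1) (hs : 0 < s) (hσ : 0 < σ)
    (hAs : m A = ENNReal.ofReal (s ^ N)) (hsσ : 2 * s ^ N ≤ σ ^ N)
    (hz : ∀ z ∈ A, ENNReal.ofReal (σ ^ N) ≤ m (ball z l))
    (hp : 0 ≤ p) (hAp : Per m A univ ≤ ENNReal.ofReal p) :
    σ * s ^ (N - 1) ≤ 2 ^ (N * k + N + 3) * CP * l * p := by
  set G : Set X := {z ∈ A | Tendsto (fun r => m (A ∩ ball z r) / m (ball z r)) (𝓝[>] 0) (𝓝 1)}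
    with hG
  have hlam0 : 0 < lam := by linarith [h.one_le_lam]
  have hCP := h.CP_pos
  have hex : ∀ z : X, ∃ r, z ∈ G → (0 < r ∧ r ≤ 1 ∧ r ≤ 4 * l * s / σ ∧
      2 * m (A ∩ ball z r) ≤ m (ball z r) ∧ m (ball z r) ≤ 2 ^ (N + 1) * m (A ∩ ball z r)) := by
    intro z
    by_cases hzG : z ∈ G
    · obtain ⟨r, hr⟩ := h.exists_radius hl hl1 hs hσ hAs hsσ (hz z hzG.1) hzG.2
      exact ⟨r, fun _ => hr⟩
    · exact ⟨0, fun h => absurd h hzG⟩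
  choose r hr using hex
  obtain ⟨u, huG, hud, huc⟩ := Vitali.exists_disjoint_subfamily_covering_enlargement_closedBall
    G id (fun z => lam * r z) lam (fun z hzG => mul_le_of_le_one_right hlam0.le (hr z hzG).2.1) 5
    (by norm_num)
  have hucount : u.Countable := by
    refine hud.countable_of_nonempty_interior fun z hzu => ?_
    have := (hr z (huG hzu)).1
    exact ⟨z, mem_interior_iff_mem_nhds.2 (closedBall_mem_nhds _ (by positivity))⟩
  have hsum : ∀ F : Finset u, ∀ c, Per m A univ < c →
      ∑ b ∈ F, m (A ∩ ball (b : X) (r b)) ≤ ENNReal.ofReal (CP * (4 * l * s / σ)) * c := by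
    intro F c hc
    obtain ⟨f, f1, f2, f3, -⟩ := exists_seq_of_per_lt isOpen_univ hc
    have hlim : Tendsto (fun n => ∑ b ∈ F, ∫⁻ y in ball (b : X) (r b),
        ENNReal.ofReal |f n y - A.indicator (fun _ => (1 : ℝ)) y| ∂m +
          ENNReal.ofReal (CP * (4 * l * s / σ)) * c) atTop
        (𝓝 (∑ b ∈ F, 0 + ENNReal.ofReal (CP * (4 * l * s / σ)) * c)) := by
      refine (tendsto_finsetSum _ fun b _ => ?_).add tendsto_const_nhds
      refine tendsto_of_tendsto_of_tendsto_of_le_of_le tendsto_const_nhds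
        (f2 (closedBall (b : X) (r b)) (subset_univ _) (isCompact_closedBall _ _))
        (fun _ => zero_le) fun n => ?_
      exact lintegral_mono_set ball_subset_closedBall
    rw [Finset.sum_const_zero, zero_add] at hlim
    refine ge_of_tendsto' hlim fun n => ?_
    calc ∑ b ∈ F, m (A ∩ ball (b : X) (r b))
        ≤ ∑ b ∈ F, (∫⁻ y in ball (b : X) (r b),
            ENNReal.ofReal |f n y - A.indicator (fun _ => (1 : ℝ)) y| ∂m +
            ENNReal.ofReal (CP * (4 * l * s / σ)) *
              ∫⁻ y in closedBall (b : X) (lam * r b), mSlope (f n) y ∂m) := by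
          refine Finset.sum_le_sum fun b _ => ?_
          obtain ⟨b1, b2, b3, b4, -⟩ := hr b (huG b.2)
          refine (h.measure_inter_ball_le hA b1 (by linarith) b4 (f1 n)).trans ?_
          gcongr
          exact ball_subset_closedBall
      _ = ∑ b ∈ F, ∫⁻ y in ball (b : X) (r b),
            ENNReal.ofReal |f n y - A.indicator (fun _ => (1 : ℝ)) y| ∂m +
            ENNReal.ofReal (CP * (4 * l * s / σ)) *
              ∑ b ∈ F, ∫⁻ y in closedBall (b : X) (lam * r b), mSlope (f n) y ∂m := by
          rw [Finset.sum_add_distrib, Finset.mul_sum]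
      _ ≤ _ := by
          gcongr
          rw [← lintegral_biUnion_finset]
          · refine (setLIntegral_le_lintegral _ _).trans ?_
            simpa only [setLIntegral_univ] using (f3 n).le
          · exact fun a _ b _ hab => hud a.2 b.2 fun h => hab (Subtype.ext h)
          · exact fun b _ => isClosed_closedBall.measurableSet
  have hmain : ∀ c, Per m A univ < c → ENNReal.ofReal (s ^ N) ≤
      2 ^ (N * k) * 2 ^ (N + 1) * (ENNReal.ofReal (CP * (4 * l * s / σ)) * c) := by
    intro c hc
    have hGA : A ≤ᵐ[m] G := by
      filter_upwards [hd] with z hz hzA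
      exact ⟨hzA, hz hzA⟩
    rw [← hAs]
    have := hucount.to_subtype
    calc m A ≤ m G := measure_mono_ae hGA
      _ ≤ m (⋃ b : u, ball (b : X) (2 ^ k * r b)) := by
          refine measure_mono fun z hzG => ?_
          obtain ⟨b, hb, hsub⟩ := huc z hzG
          refine mem_iUnion.2 ⟨⟨b, hb⟩, ?_⟩
          have hr0 := (hr z hzG).1
          have h1 := hsub (mem_closedBall_self (by positivity))
          rw [mem_closedBall] at h1
          rw [mem_ball]
          have hb0 := (hr b (huG hb)).1
          calc dist z b ≤ 5 * (lam * r b) := h1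
            _ = 5 * lam * r b := by ring
            _ < 2 ^ k * r b := by gcongr; exact h.lam_lt
      _ ≤ ∑' b : u, m (ball (b : X) (2 ^ k * r b)) := measure_iUnion_le _
      _ ≤ ∑' b : u, 2 ^ (N * k) * 2 ^ (N + 1) * m (A ∩ ball (b : X) (r b)) := by
          refine ENNReal.tsum_le_tsum fun b => ?_
          obtain ⟨b1, b2, b3, b4, b5⟩ := hr b (huG b.2)
          refine (h.ball_two_pow_mul_le b b1 b2 le_rfl).trans ?_
          rw [mul_assoc]
          gcongr
      _ = 2 ^ (N * k) * 2 ^ (N + 1) * ∑' b : u, m (A ∩ ball (b : X) (r b)) := ENNReal.tsum_mul_left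
      _ ≤ _ := by
          gcongr
          rw [ENNReal.tsum_eq_iSup_sum]
          exact iSup_le fun F => hsum F c hc
  have hfinal : ENNReal.ofReal (s ^ N) ≤
      ENNReal.ofReal (2 ^ (N * k) * 2 ^ (N + 1) * (CP * (4 * l * s / σ) * p)) := by
    have h1 : Tendsto (fun c => 2 ^ (N * k) * 2 ^ (N + 1) *
        (ENNReal.ofReal (CP * (4 * l * s / σ)) * ENNReal.ofReal c)) (𝓝[>] p)
        (𝓝 (2 ^ (N * k) * 2 ^ (N + 1) *
          (ENNReal.ofReal (CP * (4 * l * s / σ)) * ENNReal.ofReal p))) := by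
      refine ENNReal.Tendsto.const_mul (ENNReal.Tendsto.const_mul
        (ENNReal.tendsto_ofReal (tendsto_id.mono_left nhdsWithin_le_nhds)) (Or.inr (by finiteness)))
        (Or.inr (by finiteness))
    have h2 := ge_of_tendsto h1 (b := ENNReal.ofReal (s ^ N)) (by
      filter_upwards [self_mem_nhdsWithin] with c hc
      exact hmain _ (hAp.trans_lt ((ENNReal.ofReal_lt_ofReal_iff (hp.trans_lt hc)).2 hc)))
    have h3 : (2 : ℝ≥0∞) ^ (N * k) * 2 ^ (N + 1) =
        ENNReal.ofReal (2 ^ (N * k) * 2 ^ (N + 1)) := by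
      rw [ENNReal.ofReal_mul (by positivity), ENNReal.ofReal_pow zero_le_two,
        ENNReal.ofReal_pow zero_le_two, ENNReal.ofReal_ofNat]
    have := h.CP_pos
    rwa [h3, ← ENNReal.ofReal_mul (by positivity : 0 ≤ CP * (4 * l * s / σ)),
      ← ENNReal.ofReal_mul (by positivity)] at h2
  rw [ENNReal.ofReal_le_ofReal_iff (by positivity)] at hfinal
  have hN : s ^ N = s ^ (N - 1) * s := by
    rw [← pow_succ, Nat.sub_add_cancel h.one_le_N]
  have e : (2 : ℝ) ^ (N * k) * 2 ^ (N + 1) * (CP * (4 * l * s / σ) * p) =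
      2 ^ (N * k + N + 3) * CP * l * p / σ * s := by
    field_simp
    ring
  rw [hN, e] at hfinal
  have h3 := le_of_mul_le_mul_right hfinal hs
  rw [le_div_iff₀ hσ] at h3
  linarith

end LocalPI

/-! ### Differential inequalities for volume functions -/

theorem hasDerivAt_mul_sub_pow (N : ℕ) (κ a x : ℝ) :
    HasDerivAt (fun r => (κ * (r - a)) ^ N) (N * (κ * (x - a)) ^ (N - 1) * κ) x := by
  have h1 : HasDerivAt (fun r => κ * (r - a)) κ x := by
    simpa using ((hasDerivAt_id x).sub_const a).const_mul κ
  exact h1.pow N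

theorem eventually_slope {f : ℝ → ℝ} {x : ℝ} {P : ℝ → Prop}
    (h : ∀ᶠ t in 𝓝[>] (0 : ℝ), P ((f (x + t) - f x) / t)) :
    ∀ᶠ z in 𝓝[>] x, P (slope f x z) := by
  have ht : Tendsto (fun z => z - x) (𝓝[>] x) (𝓝[>] (0 : ℝ)) := by
    refine tendsto_nhdsWithin_iff.2 ⟨?_, ?_⟩
    · have : Tendsto (fun z => z - x) (𝓝 x) (𝓝 (x - x)) := (continuous_id.sub continuous_const).tendsto x
      rw [sub_self] at this
      exact this.mono_left nhdsWithin_le_nhds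
    · filter_upwards [self_mem_nhdsWithin] with z hz
      exact sub_pos.2 (mem_Ioi.1 hz)
  filter_upwards [ht.eventually h] with z hz
  rw [slope_def_field]
  simpa using hz

/-- If `f > 0` grows at rate at least `g s^(N-1)` where it takes the value `s^N`, then `f` grows
at least like the `N`-th power of the elapsed time. -/
theorem pow_le_of_growth {f : ℝ → ℝ} {a b g : ℝ} {N : ℕ} (hN : 1 ≤ N) (hab : a ≤ b) (hg : 0 < g)
    (hf : ContinuousOn f (Icc a b)) (hpos : ∀ r ∈ Icc a b, 0 < f r)
    (hgrow : ∀ r ∈ Ico a b, ∀ s, 0 < s → f r = s ^ N →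
      ∀ᶠ t in 𝓝[>] (0 : ℝ), g * s ^ (N - 1) * t ≤ f (r + t) - f r) :
    (g / (2 * N) * (b - a)) ^ N ≤ f b := by
  have hN0 : N ≠ 0 := by omega
  have hNpos : (0 : ℝ) < N := by positivity
  have key := image_le_of_liminf_slope_right_lt_deriv_boundary (f := fun r => -f r)
    (f' := fun x => -(g * (f x ^ ((N : ℝ)⁻¹)) ^ (N - 1))) (a := a) (b := b)
    (B := fun r => -(g / (2 * N) * (r - a)) ^ N)
    (B' := fun x => -(N * (g / (2 * N) * (x - a)) ^ (N - 1) * (g / (2 * N)))) hf.neg ?_ ?_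
    (fun x => (hasDerivAt_mul_sub_pow N _ a x).neg) ?_ (right_mem_Icc.2 hab)
  · simpa using key
  · intro x hx r hr
    have hfx := hpos x (Ico_subset_Icc_self hx)
    have h1 := hgrow x hx (f x ^ ((N : ℝ)⁻¹)) (by positivity)
      (Real.rpow_inv_natCast_pow hfx.le hN0).symm
    refine (eventually_slope (f := fun r => -f r) (P := (· < r)) ?_).frequently
    filter_upwards [h1, self_mem_nhdsWithin] with t ht htpos
    refine lt_of_le_of_lt ?_ hr
    rw [div_le_iff₀ htpos]
    linarith
  · simp [hN0, (hpos a (left_mem_Icc.2 hab)).le]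
  · intro x hx hfx
    have hfx' : f x = (g / (2 * N) * (x - a)) ^ N := by linarith
    have hxa : 0 ≤ g / (2 * N) * (x - a) := mul_nonneg (by positivity) (by linarith [hx.1])
    have hxa' : 0 < g / (2 * N) * (x - a) := by
      refine hxa.lt_of_ne fun h0 => ?_
      have := hpos x (Ico_subset_Icc_self hx)
      rw [hfx', ← h0, zero_pow hN0] at this
      exact this.false
    rw [hfx', Real.pow_rpow_inv_natCast hxa hN0]
    have h2 : 0 < (g / (2 * N) * (x - a)) ^ (N - 1) := by positivity
    have h3 : N * (g / (2 * N) * (x - a)) ^ (N - 1) * (g / (2 * N)) =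
        g * (g / (2 * N) * (x - a)) ^ (N - 1) / 2 := by
      generalize (g / (2 * N) * (x - a)) ^ (N - 1) = q
      field_simp
    rw [h3]
    have : 0 < g * (g / (2 * N) * (x - a)) ^ (N - 1) := by positivity
    linarith

/-- If `f` decreases at rate at least `g s^(N-1)` where it takes the value `s^N > 0`, then it
cannot stay positive for long. -/
theorem not_pos_of_decay {f : ℝ → ℝ} {a b g : ℝ} {N : ℕ} (hN : 1 ≤ N) (hab : a ≤ b) (hg : 0 < g)
    (hf : ContinuousOn f (Icc a b)) (hfa : f a ≤ (g / (2 * N) * (b - a)) ^ N)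
    (hdec : ∀ r ∈ Ico a b, ∀ s, 0 < s → f r = s ^ N →
      ∀ᶠ t in 𝓝[>] (0 : ℝ), f (r + t) - f r ≤ -(g * s ^ (N - 1) * t)) :
    ¬ ∀ r ∈ Icc a b, 0 < f r := by
  intro hpos
  have hN0 : N ≠ 0 := by omega
  have hNpos : (0 : ℝ) < N := by positivity
  have key := image_le_of_liminf_slope_right_lt_deriv_boundary (f := f)
    (f' := fun x => -(g * (f x ^ ((N : ℝ)⁻¹)) ^ (N - 1))) (a := a) (b := b)
    (B := fun r => (-(g / (2 * N)) * (r - b)) ^ N)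
    (B' := fun x => (N * (-(g / (2 * N)) * (x - b)) ^ (N - 1) * (-(g / (2 * N))))) hf ?_ ?_
    (fun x => (hasDerivAt_mul_sub_pow N _ b x)) ?_ (right_mem_Icc.2 hab)
  · have := hpos b (right_mem_Icc.2 hab)
    simp only [sub_self, mul_zero, zero_pow hN0] at key
    linarith
  · intro x hx r hr
    have hfx := hpos x (Ico_subset_Icc_self hx)
    have h1 := hdec x hx (f x ^ ((N : ℝ)⁻¹)) (by positivity)
      (Real.rpow_inv_natCast_pow hfx.le hN0).symm
    refine (eventually_slope (P := (· < r)) ?_).frequently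
    filter_upwards [h1, self_mem_nhdsWithin] with t ht htpos
    refine lt_of_le_of_lt ?_ hr
    rw [div_le_iff₀ htpos]
    linarith
  · refine hfa.trans_eq ?_
    ring_nf
  · intro x hx hfx
    have hxa : 0 < -(g / (2 * N)) * (x - b) :=
      mul_pos_of_neg_of_neg (by simp; positivity) (by linarith [hx.2])
    rw [hfx, Real.pow_rpow_inv_natCast hxa.le hN0]
    have h2 : 0 < (-(g / (2 * N)) * (x - b)) ^ (N - 1) := by positivity
    have h3 : N * (-(g / (2 * N)) * (x - b)) ^ (N - 1) * (-(g / (2 * N))) =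
        -(g * (-(g / (2 * N)) * (x - b)) ^ (N - 1) / 2) := by
      generalize (-(g / (2 * N)) * (x - b)) ^ (N - 1) = q
      field_simp
    rw [h3]
    have : 0 < g * (-(g / (2 * N)) * (x - b)) ^ (N - 1) := by positivity
    linarith

theorem max_growth_aux {v w : ℝ → ℝ} {a b g₁ g₂ e₁ e₂ : ℝ} {N : ℕ} (hN : 1 ≤ N)
    (hab : a < b) (hg : 0 < g₁) (hgg : g₁ ≤ g₂)
    (hvm : MonotoneOn v (Icc a b)) (hwm : MonotoneOn w (Icc a b))
    (hv : ContinuousOn v (Icc a b)) (hw : ContinuousOn w (Icc a b))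
    (hpos : 0 < max (v a) (w a))
    (hv' : ∀ r ∈ Ico a b, ∀ s, 0 < s → v r = s ^ N → w r ≤ v r →
      ∀ᶠ t in 𝓝[>] (0 : ℝ), g₁ * s ^ (N - 1) * t ≤ v (r + t) - v r)
    (hw' : ∀ r ∈ Ico a b, ∀ s, 0 < s → w r = s ^ N → v r ≤ w r →
      ∀ᶠ t in 𝓝[>] (0 : ℝ), g₂ * s ^ (N - 1) * t ≤ w (r + t) - w r)
    (he₁ : 0 ≤ e₁) (he₂ : 0 ≤ e₂)
    (he₁' : e₁ < g₁ / (2 * N) * ((b - a) / 2)) (he₂' : e₂ < g₂ / (2 * N) * ((b - a) / 2))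
    (hvb : v b ≤ e₁ ^ N) (hwb : w b ≤ e₂ ^ N) : False := by
  have hN0 : N ≠ 0 := by omega
  set c := (a + b) / 2 with hc
  have hac : a ≤ c := by linarith
  have hcb : c ≤ b := by linarith
  have hIc : Icc a c ⊆ Icc a b := Icc_subset_Icc_right hcb
  have hIc' : Icc c b ⊆ Icc a b := Icc_subset_Icc_left hac
  have hg2 : 0 < g₂ := hg.trans_le hgg
  have hmm : MonotoneOn (fun r => max (v r) (w r)) (Icc a b) := fun x hx y hy hxy =>
    max_le_max (hvm hx hy hxy) (hwm hx hy hxy)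
  have hmid := pow_le_of_growth (f := fun r => max (v r) (w r)) hN hac hg
    ((hv.mono hIc).sup (hw.mono hIc))
    (fun r hr => hpos.trans_le (hmm (left_mem_Icc.2 hab.le) (hIc hr) hr.1)) (by
      intro r hr s hs hrs
      have hr' : r ∈ Ico a b := ⟨hr.1, hr.2.trans_le hcb⟩
      rcases le_total (w r) (v r) with h | h
      · simp only [max_eq_left h] at hrs ⊢
        filter_upwards [hv' r hr' s hs hrs h] with t ht
        exact ht.trans (sub_le_sub_right (le_max_left _ _) _)
      · simp only [max_eq_right h] at hrs ⊢
        filter_upwards [hw' r hr' s hs hrs h, self_mem_nhdsWithin] with t ht htpos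
        have htpos : (0 : ℝ) < t := htpos
        have h1 : g₁ * s ^ (N - 1) * t ≤ g₂ * s ^ (N - 1) * t := by gcongr
        exact (h1.trans ht).trans (sub_le_sub_right (le_max_right _ _) _))
  have hcm : c - a = (b - a) / 2 := by rw [hc]; ring
  have hbc : b - c = (b - a) / 2 := by rw [hc]; ring
  rw [hcm] at hmid
  have hmid' : e₁ ^ N < max (v c) (w c) := (pow_lt_pow_left₀ he₁' he₁ hN0).trans_le hmid
  have hcI : c ∈ Icc a b := ⟨hac, hcb⟩
  have hbI : b ∈ Icc a b := right_mem_Icc.2 hab.le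
  have hvr : ∀ r ∈ Icc c b, v r ≤ e₁ ^ N := fun r hr => (hvm (hIc' hr) hbI hr.2).trans hvb
  have hwc : e₁ ^ N < w c := by
    rcases lt_max_iff.1 hmid' with h | h
    · exact absurd (hvr c (left_mem_Icc.2 hcb)) h.not_ge
    · exact h
  have hwr : ∀ r ∈ Icc c b, e₁ ^ N < w r := fun r hr => hwc.trans_le (hwm hcI (hIc' hr) hr.1)
  have hend := pow_le_of_growth (f := w) hN hcb hg2 (hw.mono hIc')
    (fun r hr => (pow_nonneg he₁ N).trans_lt (hwr r hr)) (fun r hr s hs hrs =>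
      hw' r ⟨hac.trans hr.1, hr.2⟩ s hs hrs
        ((hvr r (Ico_subset_Icc_self hr)).trans (hwr r (Ico_subset_Icc_self hr)).le))
  rw [hbc] at hend
  exact ((pow_lt_pow_left₀ he₂' he₂ hN0).trans_le hend).not_ge hwb

/-- Two monotone functions, the larger of which always grows quickly, cannot both end up small
unless they start out nonpositive. -/
theorem max_nonpos_of_growth {v w : ℝ → ℝ} {a b g₁ g₂ e₁ e₂ : ℝ} {N : ℕ} (hN : 1 ≤ N)
    (hab : a < b) (hg₁ : 0 < g₁) (hg₂ : 0 < g₂)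
    (hvm : MonotoneOn v (Icc a b)) (hwm : MonotoneOn w (Icc a b))
    (hv : ContinuousOn v (Icc a b)) (hw : ContinuousOn w (Icc a b))
    (hv' : ∀ r ∈ Ico a b, ∀ s, 0 < s → v r = s ^ N → w r ≤ v r →
      ∀ᶠ t in 𝓝[>] (0 : ℝ), g₁ * s ^ (N - 1) * t ≤ v (r + t) - v r)
    (hw' : ∀ r ∈ Ico a b, ∀ s, 0 < s → w r = s ^ N → v r ≤ w r →
      ∀ᶠ t in 𝓝[>] (0 : ℝ), g₂ * s ^ (N - 1) * t ≤ w (r + t) - w r)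
    (he₁ : 0 ≤ e₁) (he₂ : 0 ≤ e₂)
    (he₁' : e₁ < g₁ / (2 * N) * ((b - a) / 2)) (he₂' : e₂ < g₂ / (2 * N) * ((b - a) / 2))
    (hvb : v b ≤ e₁ ^ N) (hwb : w b ≤ e₂ ^ N) : max (v a) (w a) ≤ 0 := by
  by_contra! hpos
  rcases le_total g₁ g₂ with h | h
  · exact max_growth_aux hN hab hg₁ h hvm hwm hv hw hpos hv' hw' he₁ he₂ he₁' he₂' hvb hwb
  · rw [max_comm] at hpos
    exact max_growth_aux hN hab hg₂ h hwm hvm hw hv hpos hw' hv' he₂ he₁ he₂' he₁' hwb hvb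

/-! ### Volume-constrained minimizers and cuts by balls -/

theorem measure_inter_closedBall_eq_ball [MetricSpace X] [MeasurableSpace X] {m : Measure X}
    (hsph : ∀ (x : X) (r : ℝ), 0 < r → m (sphere x r) = 0)
    (A : Set X) (x : X) {r : ℝ} (hr : 0 < r) : m (A ∩ closedBall x r) = m (A ∩ ball x r) := by
  have hae : (closedBall x r : Set X) =ᵐ[m] ball x r := by
    rw [← ball_union_sphere]
    exact union_ae_eq_left_of_ae_eq_empty (ae_eq_empty.2 (hsph x r hr))
  exact measure_congr (Filter.EventuallyEq.rfl.inter hae)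

namespace LocalPI
variable [MetricSpace X] [MeasurableSpace X] [BorelSpace X] [ProperSpace X] {m : Measure X}
  {N k : ℕ} {lam CP : ℝ}

theorem ae_tendsto_density (h : LocalPI m N k lam CP)
    (hsph : ∀ (x : X) (r : ℝ), 0 < r → m (sphere x r) = 0) {A : Set X} (hA : MeasurableSet A) :
    ∀ᵐ z ∂m, z ∈ A → Tendsto (fun r => m (A ∩ ball z r) / m (ball z r)) (𝓝[>] 0) (𝓝 1) := by
  have := h.isUnifLocDoublingMeasure
  have := h.isLocallyFiniteMeasure
  rw [← ae_restrict_iff' hA]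
  filter_upwards [IsUnifLocDoublingMeasure.ae_tendsto_measure_inter_div m A 1] with z hz
  have hz' := hz (l := 𝓝[>] (0 : ℝ)) (fun _ => z) id tendsto_id (by
    filter_upwards [self_mem_nhdsWithin] with r hr
    simpa using (mem_Ioi.1 hr).le)
  refine hz'.congr' ?_
  filter_upwards [self_mem_nhdsWithin] with r hr
  have huniv := measure_inter_closedBall_eq_ball hsph univ z hr
  rw [univ_inter, univ_inter] at huniv
  rw [id, measure_inter_closedBall_eq_ball hsph A z hr, huniv]

theorem isoperimetric_of_cut (h : LocalPI m N k lam CP)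
    (hsph : ∀ (x : X) (r : ℝ), 0 < r → m (sphere x r) = 0) {A B B' : Set X}
    (hB : MeasurableSet B) {l s σ D Q : ℝ} {P : ℝ≥0∞} (hP : P ≠ ∞) (hD : 0 ≤ D) (hQ : 0 ≤ Q)
    (hcut : Per m B univ + Per m B' univ ≤ Per m A univ + ENNReal.ofReal (2 * D))
    (hPA : Per m A univ ≤ P + ENNReal.ofReal Q) (hPB' : P ≤ Per m B' univ)
    (hl : 0 < l) (hl1 : l ≤ 1) (hs : 0 < s) (hσ : 0 < σ)
    (hBs : m B = ENNReal.ofReal (s ^ N)) (hsσ : 2 * s ^ N ≤ σ ^ N)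
    (hz : ∀ z ∈ B, ENNReal.ofReal (σ ^ N) ≤ m (ball z l)) :
    σ * s ^ (N - 1) ≤ 2 ^ (N * k + N + 3) * CP * l * (Q + 2 * D) := by
  refine h.isoperimetric hB (h.ae_tendsto_density hsph hB) hl hl1 hs hσ hBs hsσ hz (by positivity)
    ?_
  rw [ENNReal.ofReal_add hQ (by positivity)]
  refine (ENNReal.add_le_add_iff_right hP).1 ?_
  calc Per m B univ + P ≤ Per m B univ + Per m B' univ := by gcongr
    _ ≤ Per m A univ + ENNReal.ofReal (2 * D) := hcut
    _ ≤ P + ENNReal.ofReal Q + ENNReal.ofReal (2 * D) := by gcongr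
    _ = _ := by ring

/-- If one of the two pieces obtained by cutting `A` along a sphere has little volume and the
other one has at least as much perimeter as a reference set of comparable perimeter, then `A`
has a lot of volume near that sphere. -/
theorem eventually_le_ballVol_sub (h : LocalPI m N k lam CP)
    (hsph : ∀ (x : X) (r : ℝ), 0 < r → m (sphere x r) = 0) {A B B' E : Set X} {o : X} {ρ : ℝ}
    (hρ : 0 < ρ) (hA : MeasurableSet A) (hE : MeasurableSet E)
    (hBB : (B = A ∩ closedBall o ρ ∧ B' = A \ closedBall o ρ) ∨
      (B = A \ closedBall o ρ ∧ B' = A ∩ closedBall o ρ))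
    (hAE : ∀ᶠ t in 𝓝[>] (0 : ℝ), A ∩ {y | ρ ≤ dist y o ∧ dist y o ≤ ρ + t} ⊆ E)
    {l s σ D Q : ℝ} {P : ℝ≥0∞} (hP : P ≠ ∞) (hD : 0 ≤ D) (hQ : 0 ≤ Q)
    (hPA : Per m A univ ≤ P + ENNReal.ofReal Q) (hPB' : P ≤ Per m B' univ)
    (hl : 0 < l) (hl1 : l ≤ 1) (hs : 0 < s) (hσ : 0 < σ)
    (hBs : m B = ENNReal.ofReal (s ^ N)) (hsσ : 2 * s ^ N ≤ σ ^ N)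
    (hz : ∀ z ∈ B, ENNReal.ofReal (σ ^ N) ≤ m (ball z l))
    (hlt : 2 ^ (N * k + N + 3) * CP * l * (Q + 2 * D) < σ * s ^ (N - 1)) :
    ∀ᶠ t in 𝓝[>] (0 : ℝ), D * t ≤ ballVol m E o (ρ + t) - ballVol m E o ρ := by
  have := h.isFiniteMeasureOnCompacts
  by_contra hcon
  have hfreq : ∃ᶠ t in 𝓝[>] (0 : ℝ),
      m (A ∩ {y | ρ ≤ dist y o ∧ dist y o ≤ ρ + t}) ≤ ENNReal.ofReal (D * t) := by
    refine ((not_eventually.1 hcon).and_eventually (hAE.and self_mem_nhdsWithin)).mono ?_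
    rintro t ⟨h1, h2, h3⟩
    have h3 : 0 < t := h3
    calc m (A ∩ {y | ρ ≤ dist y o ∧ dist y o ≤ ρ + t})
        ≤ m (E ∩ {y | ρ ≤ dist y o ∧ dist y o ≤ ρ + t}) :=
          measure_mono (subset_inter h2 inter_subset_right)
      _ ≤ ENNReal.ofReal (ballVol m E o (ρ + t) - ballVol m E o ρ) :=
          measure_inter_annulus_le (h.ball_lt_top o) hE h3.le (hsph o _ (by linarith))
      _ ≤ _ := ENNReal.ofReal_le_ofReal (not_le.1 h1).le
  have hcut := Per_inter_add_Per_diff_le m hA o ρ hD hfreq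
  have hBm : MeasurableSet B := by
    rcases hBB with ⟨rfl, -⟩ | ⟨rfl, -⟩
    · exact hA.inter measurableSet_closedBall
    · exact hA.diff measurableSet_closedBall
  refine hlt.not_ge (h.isoperimetric_of_cut hsph (A := A) (B' := B') hBm hP hD hQ ?_ hPA hPB' hl
    hl1 hs hσ hBs hsσ hz)
  rcases hBB with ⟨rfl, rfl⟩ | ⟨rfl, rfl⟩
  · exact hcut
  · rwa [add_comm (Per m _ _)]

end LocalPI

/-- `E` has finite perimeter, and least perimeter among the sets obtained from it by exchanging
equal (possibly infinite) volumes. -/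
structure IsVolumeMin [MetricSpace X] [MeasurableSpace X] (m : Measure X) (E : Set X) : Prop where
  measurableSet : MeasurableSet E
  per_ne_top : Per m E univ ≠ ∞
  per_le : ∀ F, MeasurableSet F → m (F \ E) = m (E \ F) → Per m E univ ≤ Per m F univ

theorem IsVolumeMin.compl [MetricSpace X] [MeasurableSpace X] [BorelSpace X] {m : Measure X} {E : Set X}
    (h : IsVolumeMin m E) : IsVolumeMin m Eᶜ where
  measurableSet := h.measurableSet.compl
  per_ne_top := by rw [Per_compl m isOpen_univ]; exact h.per_ne_top
  per_le F hF hFE := by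
    rw [Per_compl m isOpen_univ, ← Per_compl m (E := F) isOpen_univ]
    refine h.per_le _ hF.compl ?_
    have h1 : Fᶜ \ E = Eᶜ \ F := by ext; simp [and_comm]
    have h2 : E \ Fᶜ = F \ Eᶜ := by ext; simp [and_comm]
    rw [h1, h2, hFE]

theorem IsIsoperimetricSet.isVolumeMin [MetricSpace X] [MeasurableSpace X] {m : Measure X}
    {E : Set X} (h : IsIsoperimetricSet m E) : IsVolumeMin m E where
  measurableSet := h.1
  per_ne_top := h.2.1.ne
  per_le F hF hFE := by
    refine h.2.2.2.2 F hF ?_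
    rw [← measure_inter_add_sdiff F h.1, ← measure_inter_add_sdiff E hF, hFE, inter_comm]

/-! ### Filling in small balls -/

/-- Starting from a ball `ball y a` contained in `E` up to a null set, `E` can be enlarged by
balls centred at `y` with control on the perimeter. -/
structure BallFilling [MetricSpace X] [MeasurableSpace X] (m : Measure X) (E : Set X) (y : X)
    (a R C : ℝ) : Prop where
  nonneg : 0 ≤ a
  lt : a < R
  C_nonneg : 0 ≤ C
  closedBall_eq_zero : m (Eᶜ ∩ closedBall y a) = 0
  pos : ∀ s, a < s → 0 < m (Eᶜ ∩ ball y s)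
  density : Tendsto (fun r => m (Eᶜ ∩ ball y r) / m (ball y r)) (𝓝[>] 0) (𝓝 0)
  per_le : ∀ s, 0 < s → s < R → Per m (E ∪ ball y s) univ ≤
    ENNReal.ofReal C * m (Eᶜ ∩ ball y s) / ENNReal.ofReal s + Per m E univ

namespace LocalPI
variable [MetricSpace X] [MeasurableSpace X] [BorelSpace X] {m : Measure X}
  {N k : ℕ} {lam CP : ℝ}

theorem ballVol_continuousOn (h : LocalPI m N k lam CP)
    (hsph : ∀ (x : X) (r : ℝ), 0 < r → m (sphere x r) = 0) {A : Set X} (hA : MeasurableSet A)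
    (x : X) {a b : ℝ} (ha : 0 < a) : ContinuousOn (ballVol m A x) (Icc a b) := fun s hs =>
  (ballVol_continuousAt (h.ball_lt_top x) hA (hsph x s (ha.trans_le hs.1))).continuousWithinAt

/-- A volume minimizer with little volume near `x` that can be filled in near `y` has volume
growing fast around `x`: cut out a small ball at `x` and make up for it at `y`. -/
theorem growth_of_ballFilling [ProperSpace X] (h : LocalPI m N k lam CP)
    (hsph : ∀ (x : X) (r : ℝ), 0 < r → m (sphere x r) = 0) {E : Set X} (hmin : IsVolumeMin m E)
    {x y : X} {a R C r₁ r₂ r₀ σ ε : ℝ} (hf : BallFilling m E y a R C)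
    (hr : r₁ + r₂ < dist x y) (hr₂R : r₂ < R) (hr₀ : 0 < r₀) (hr₀1 : r₀ ≤ 1 / 2)
    (hr₀r₁ : r₀ ≤ r₁) (hr₀r₂ : r₀ ≤ r₂) (hσ : 0 < σ) (hε : ε ≤ 1 / 2)
    (hεC : 16 * (2 ^ (N * k + N + 3) * CP) * C * ε ≤ 1) (hε0 : 0 ≤ ε)
    (hσx : ENNReal.ofReal (σ ^ N) ≤ m (ball x r₀)) (hv : ballVol m E x r₀ ≤ (ε * σ) ^ N)
    (hvy : ballVol m E x r₀ ≤ ballVol m Eᶜ y r₂) {r s : ℝ} (hrI : r ∈ Ico (r₀ / 2) r₀)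
    (hs : 0 < s) (hrs : ballVol m E x r = s ^ N) (hle : ballVol m Eᶜ y r ≤ ballVol m E x r) :
    ∀ᶠ t in 𝓝[>] (0 : ℝ), σ / (8 * (2 ^ (N * k + N + 3) * CP) * r₀) * s ^ (N - 1) * t ≤
      ballVol m E x (r + t) - ballVol m E x r := by
  have hN := h.one_le_N
  have hN0 : N ≠ 0 := by omega
  have hK : 0 < 2 ^ (N * k + N + 3) * CP := mul_pos (by positivity) h.CP_pos
  set K := 2 ^ (N * k + N + 3) * CP with hKdef
  have hE := hmin.measurableSet
  have hr0 : 0 < r := by linarith [hrI.1]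
  have hC := hf.C_nonneg
  have hmono := ballVol_mono (A := E) (h.ball_lt_top x)
  obtain ⟨s', ⟨hs'1, hs'2⟩, hs'⟩ := intermediate_value_Icc (hrI.2.le.trans hr₀r₂)
    (h.ballVol_continuousOn hsph hE.compl y hr0) ⟨hle, (hmono hrI.2.le).trans hvy⟩
  have hs'0 : 0 < s' := hr0.trans_le hs'1
  have hdisj : ∀ z, dist z x ≤ r₁ → z ∉ ball y s' := by
    intro z hz hzy
    have := dist_triangle_left x y z
    rw [mem_ball] at hzy
    linarith
  have hmx : m (E ∩ closedBall x r) = ENNReal.ofReal (s ^ N) := by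
    rw [measure_inter_closedBall_eq_ball hsph E x hr0, ← ofReal_ballVol (h.ball_lt_top x), hrs]
  have hmy : m (Eᶜ ∩ ball y s') = ENNReal.ofReal (s ^ N) := by
    rw [← ofReal_ballVol (h.ball_lt_top y), hs', hrs]
  have hsε : s ≤ ε * σ := by
    have : s ^ N ≤ (ε * σ) ^ N := hrs ▸ (hmono hrI.2.le).trans hv
    exact (pow_le_pow_iff_left₀ hs.le (by positivity) hN0).1 this
  have hsq : s ^ N = s ^ (N - 1) * s := by
    rw [← pow_succ, Nat.sub_add_cancel hN]
  have hq : 0 < s ^ (N - 1) := by positivity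
  set q := s ^ (N - 1)
  have hBeq : (E ∪ ball y s') ∩ closedBall x r = E ∩ closedBall x r := by
    ext z
    simp only [mem_inter_iff, mem_union, mem_closedBall]
    constructor
    · rintro ⟨h1 | h1, h2⟩
      · exact ⟨h1, h2⟩
      · exact absurd h1 (hdisj z (by linarith [hrI.2]))
    · rintro ⟨h1, h2⟩
      exact ⟨Or.inl h1, h2⟩
  have hB' : MeasurableSet ((E ∪ ball y s') \ closedBall x r) :=
    (hE.union measurableSet_ball).diff measurableSet_closedBall
  have hannulus : ∀ᶠ t in 𝓝[>] (0 : ℝ),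
      (E ∪ ball y s') ∩ {z | r ≤ dist z x ∧ dist z x ≤ r + t} ⊆ E := by
    filter_upwards [Ioo_mem_nhdsGT (sub_pos.2 hrI.2)] with t ht
    rintro z ⟨h1 | h1, h2⟩
    · exact h1
    · exact absurd h1 (hdisj z (by linarith [h2.2, ht.2]))
  have hperA : Per m (E ∪ ball y s') univ ≤
      Per m E univ + ENNReal.ofReal (2 * C * s ^ N / r₀) := by
    refine (hf.per_le s' hs'0 (hs'2.trans_lt hr₂R)).trans ?_
    rw [add_comm]
    gcongr
    rw [hmy, ← ENNReal.ofReal_mul hC, ← ENNReal.ofReal_div_of_pos hs'0]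
    refine ENNReal.ofReal_le_ofReal ?_
    rw [div_le_div_iff₀ hs'0 hr₀]
    have : 0 ≤ C * s ^ N := by positivity
    nlinarith [hrI.1]
  have hperB : Per m E univ ≤ Per m ((E ∪ ball y s') \ closedBall x r) univ := by
    refine hmin.per_le _ hB' ?_
    have e1 : ((E ∪ ball y s') \ closedBall x r) \ E = Eᶜ ∩ ball y s' := by
      ext z
      simp only [Set.mem_sdiff, mem_union, mem_closedBall, mem_inter_iff, mem_compl_iff]
      constructor
      · rintro ⟨⟨h1 | h1, h2⟩, h3⟩
        · exact absurd h1 h3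
        · exact ⟨h3, h1⟩
      · rintro ⟨h1, h2⟩
        exact ⟨⟨Or.inr h2, fun h3 => hdisj z (by linarith [hrI.2, mem_closedBall.1 h3]) h2⟩, h1⟩
    have e2 : E \ ((E ∪ ball y s') \ closedBall x r) = E ∩ closedBall x r := by
      ext z
      simp only [Set.mem_sdiff, mem_union, mem_inter_iff]
      tauto
    rw [e1, e2, hmx, hmy]
  refine h.eventually_le_ballVol_sub hsph hr0 (hE.union measurableSet_ball) hE
    (Or.inl ⟨rfl, rfl⟩) hannulus (l := 2 * r₀) (s := s) (σ := σ)
    (D := σ / (8 * K * r₀) * q) (Q := 2 * C * s ^ N / r₀)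
    hmin.per_ne_top (by positivity) (by positivity) hperA hperB (by positivity) (by linarith) hs hσ
    (by rw [hBeq, hmx]) ?_ ?_ ?_
  · have h1 : s ^ N ≤ (σ / 2) ^ N := pow_le_pow_left₀ hs.le (by nlinarith) N
    have h2 : (2 : ℝ) ≤ 2 ^ N := by
      calc (2 : ℝ) = 2 ^ 1 := (pow_one _).symm
        _ ≤ 2 ^ N := pow_le_pow_right₀ (by norm_num) hN
    rw [div_pow, le_div_iff₀ (by positivity)] at h1
    have : 0 < s ^ N := by positivity
    nlinarith
  · intro z hz
    refine hσx.trans (measure_mono (ball_subset_ball' ?_))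
    have := mem_closedBall'.1 hz.2
    linarith [hrI.2]
  · have e : K * (2 * r₀) * (2 * C * s ^ N / r₀ + 2 * (σ / (8 * K * r₀) * q)) =
        4 * K * C * q * s + σ * q / 2 := by
      rw [hsq]
      field_simp
      ring
    rw [e]
    have h1 : 4 * K * C * q * s ≤ 4 * K * C * q * (ε * σ) := by gcongr
    have h2 : 16 * K * C * ε * (σ * q) ≤ 1 * (σ * q) := by gcongr
    have : 0 < σ * q := by positivity
    linarith

end LocalPI

namespace LocalPI
variable [MetricSpace X] [MeasurableSpace X] {m : Measure X}
  {N k : ℕ} {lam CP : ℝ}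

theorem tendsto_density_compl (h : LocalPI m N k lam CP) {A : Set X} (hA : MeasurableSet A)
    {z : X} (hz : Tendsto (fun r => m (A ∩ ball z r) / m (ball z r)) (𝓝[>] 0) (𝓝 1)) :
    Tendsto (fun r => m (Aᶜ ∩ ball z r) / m (ball z r)) (𝓝[>] 0) (𝓝 0) := by
  have h1 := ENNReal.Tendsto.sub (tendsto_const_nhds (x := (1 : ℝ≥0∞)) (f := 𝓝[>] (0 : ℝ))) hz
    (Or.inl one_ne_top)
  rw [tsub_self] at h1
  refine h1.congr' ?_
  filter_upwards [self_mem_nhdsWithin] with r hr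
  have hpos := (h.ball_pos z r hr).ne'
  have hfin := (h.ball_lt_top z r).ne
  have h2 : m (A ∩ ball z r) / m (ball z r) + m (Aᶜ ∩ ball z r) / m (ball z r) = 1 := by
    rw [← ENNReal.add_div, inter_comm A, inter_comm Aᶜ, ← Set.sdiff_eq,
      measure_inter_add_sdiff _ hA, ENNReal.div_self hpos hfin]
  rw [← h2, ENNReal.add_sub_cancel_left]
  exact ENNReal.div_ne_top (ne_top_of_le_ne_top hfin (measure_mono inter_subset_right)) hpos

/-- If a set of finite perimeter and positive co-measure has an interior point up to null sets,
then it can be filled in near a point of the boundary of its measure-theoretic interior. -/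
theorem exists_ballFilling_of_interior [BorelSpace X] [ProperSpace X] [PreconnectedSpace X]
    (h : LocalPI m N k lam CP)
    (hsph : ∀ (x : X) (r : ℝ), 0 < r → m (sphere x r) = 0) (hdef : DeformationProperty m)
    {E : Set X} (hE : MeasurableSet E) (hper : Per m E univ ≠ ∞) (hEc : m Eᶜ ≠ 0)
    (hI : ∃ (y : X) (r : ℝ), 0 < r ∧ m (Eᶜ ∩ ball y r) = 0) :
    ∃ (y : X) (a R C : ℝ), 0 < a ∧ BallFilling m E y a R C := by
  set I : Set X := {y | ∃ r, 0 < r ∧ m (Eᶜ ∩ ball y r) = 0} with hIdef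
  have hIo : IsOpen I := by
    refine Metric.isOpen_iff.2 fun y ⟨r, hr, hy⟩ => ⟨r, hr, fun z hz => ?_⟩
    refine ⟨r - dist z y, sub_pos.2 hz, measure_mono_null (inter_subset_inter_right _ ?_) hy⟩
    exact ball_subset_ball' (by linarith)
  have hIu : I ≠ univ := by
    intro hu
    refine hEc (measure_null_of_locally_null _ fun z _ => ?_)
    obtain ⟨r, hr, hz⟩ : z ∈ I := hu ▸ mem_univ z
    exact ⟨Eᶜ ∩ ball z r, inter_mem_nhdsWithin _ (ball_mem_nhds z hr), hz⟩
  have hIne : I.Nonempty := hI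
  obtain ⟨x, hxc, hxI⟩ : ∃ x ∈ closure I, x ∉ I := by
    by_contra! hcl
    exact hIu (IsClopen.eq_univ ⟨closure_subset_iff_isClosed.1 hcl, hIo⟩ hIne)
  obtain ⟨R, hR0, -, C, hC, hineq⟩ := hdef E hE (fun x =>
    ⟨1, one_pos, (Per_mono m E (subset_univ _)).trans_lt hper.lt_top⟩) x
  obtain ⟨y, ⟨r, hr, hyr⟩, hxy⟩ := Metric.mem_closure_iff.1 hxc R hR0
  set S : Set ℝ := {s | m (Eᶜ ∩ ball y s) = 0} with hS
  have hSle : ∀ s ∈ S, s ≤ dist x y := by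
    intro s hs
    by_contra! hlt
    exact hxI ⟨s - dist x y, sub_pos.2 hlt,
      measure_mono_null (inter_subset_inter_right _ (ball_subset_ball' (by linarith))) hs⟩
  have hSb : BddAbove S := ⟨_, hSle⟩
  have ha0 : 0 < sSup S := hr.trans_le (le_csSup hSb hyr)
  have hzero : m (Eᶜ ∩ ball y (sSup S)) = 0 := by
    have hcont : ContinuousAt (ballVol m Eᶜ y) (sSup S) :=
      ballVol_continuousAt (h.ball_lt_top y) hE.compl (hsph y _ ha0)
    have h0 : ∀ᶠ s in 𝓝[<] (sSup S), ballVol m Eᶜ y s = 0 := by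
      filter_upwards [self_mem_nhdsWithin] with s hs
      obtain ⟨t, ht, hst⟩ := exists_lt_of_lt_csSup ⟨r, hyr⟩ hs
      rw [ballVol, measure_mono_null (inter_subset_inter_right _ (ball_subset_ball hst.le)) ht,
        toReal_zero]
    have := tendsto_nhds_unique ((hcont.tendsto.mono_left nhdsWithin_le_nhds).congr' h0)
      tendsto_const_nhds
    rw [← ofReal_ballVol (h.ball_lt_top y), this, ofReal_zero]
  refine ⟨y, sSup S, R, C, ha0, ha0.le, (csSup_le ⟨r, hyr⟩ hSle).trans_lt hxy, hC, ?_, ?_, ?_, ?_⟩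
  · rwa [measure_inter_closedBall_eq_ball hsph _ _ ha0]
  · intro s hs
    exact pos_iff_ne_zero.2 fun h0 => hs.not_ge (le_csSup hSb h0)
  · refine tendsto_const_nhds.congr' ?_
    filter_upwards [Ioo_mem_nhdsGT ha0] with s hs
    rw [measure_mono_null (inter_subset_inter_right _ (ball_subset_ball hs.2.le)) hzero,
      ENNReal.zero_div]
  · intro s hs0 hsR
    have := Per_union_ball_le hE hper hineq (y := y) (by rwa [mem_ball']) ⟨hs0, hsR⟩
    rwa [Set.sdiff_eq, inter_comm] at this

theorem exists_ballFilling_of_density [BorelSpace X] [ProperSpace X] (h : LocalPI m N k lam CP)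
    (hdef : DeformationProperty m)
    {E : Set X} (hE : MeasurableSet E) (hper : Per m E univ ≠ ∞)
    (hI : ¬ ∃ (y : X) (r : ℝ), 0 < r ∧ m (Eᶜ ∩ ball y r) = 0) {y : X} (hy : y ∈ E)
    (hyd : Tendsto (fun r => m (E ∩ ball y r) / m (ball y r)) (𝓝[>] 0) (𝓝 1)) :
    ∃ R C : ℝ, BallFilling m E y 0 R C := by
  obtain ⟨R, hR0, -, C, hC, hineq⟩ := hdef E hE (fun x =>
    ⟨1, one_pos, (Per_mono m E (subset_univ _)).trans_lt hper.lt_top⟩) y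
  refine ⟨R, C, le_rfl, hR0, hC, ?_, ?_, h.tendsto_density_compl hE hyd, ?_⟩
  · have : Eᶜ ∩ closedBall y 0 = ∅ := by
      rw [closedBall_zero, inter_singleton_eq_empty]
      exact fun h => h hy
    rw [this, measure_empty]
  · exact fun s hs => pos_iff_ne_zero.2 fun h0 => hI ⟨y, s, hs, h0⟩
  · intro s hs0 hsR
    have := Per_union_ball_le hE hper hineq (mem_ball_self hR0) ⟨hs0, hsR⟩
    rwa [Set.sdiff_eq, inter_comm] at this

theorem exists_ballFilling [BorelSpace X] [ProperSpace X] [PreconnectedSpace X] (h : LocalPI m N k lam CP)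
    (hsph : ∀ (x : X) (r : ℝ), 0 < r → m (sphere x r) = 0) (hdef : DeformationProperty m)
    {E : Set X} (hE : MeasurableSet E) (hper : Per m E univ ≠ ∞) (hE0 : m E ≠ 0)
    (hEc : m Eᶜ ≠ 0) : ∃ (y : X) (a R C : ℝ), BallFilling m E y a R C := by
  by_cases hI : ∃ (y : X) (r : ℝ), 0 < r ∧ m (Eᶜ ∩ ball y r) = 0
  · obtain ⟨y, a, R, C, -, hf⟩ := h.exists_ballFilling_of_interior hsph hdef hE hper hEc hI
    exact ⟨y, a, R, C, hf⟩
  · obtain ⟨y, hyE, hy⟩ := (frequently_ae_mem_iff.2 hE0).and_eventually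
      (h.ae_tendsto_density hsph hE) |>.exists
    obtain ⟨R, C, hf⟩ := h.exists_ballFilling_of_density hdef hE hper hI hyE (hy hyE)
    exact ⟨y, 0, R, C, hf⟩

end LocalPI

namespace LocalPI
variable [MetricSpace X] [MeasurableSpace X] {m : Measure X}
  {N k : ℕ} {lam CP : ℝ}

theorem eventually_ballVol_le (h : LocalPI m N k lam CP) {A : Set X} {x : X}
    (hd : Tendsto (fun r => m (A ∩ ball x r) / m (ball x r)) (𝓝[>] 0) (𝓝 0)) {η : ℝ}
    (hη : 0 < η) :
    ∀ᶠ r in 𝓝[>] (0 : ℝ), ballVol m A x r ≤ η * (m (ball x r)).toReal := by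
  filter_upwards [hd.eventually_lt_const (ENNReal.ofReal_pos.2 hη), self_mem_nhdsWithin] with r hr
    hr0
  rw [← ENNReal.toReal_ofReal hη.le, ← ENNReal.toReal_mul]
  refine ENNReal.toReal_mono (mul_ne_top ofReal_ne_top (h.ball_lt_top x r).ne) ?_
  exact (ENNReal.div_le_iff (h.ball_pos x r hr0).ne' (h.ball_lt_top x r).ne).1 hr.le

theorem eventually_ballVol_le' (h : LocalPI m N k lam CP) {A : Set X} {x : X}
    (hd : Tendsto (fun r => m (A ∩ ball x r) / m (ball x r)) (𝓝[>] 0) (𝓝 0)) {η v : ℝ}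
    (hη : 0 < η) (hv : 0 < v) :
    ∀ᶠ r in 𝓝[>] (0 : ℝ), ballVol m A x r ≤ v ∧ ballVol m A x r ≤ η * (m (ball x r)).toReal := by
  have hM : 0 < (m (ball x 1)).toReal :=
    ENNReal.toReal_pos (h.ball_pos x 1 one_pos).ne' (h.ball_lt_top x 1).ne
  filter_upwards [h.eventually_ballVol_le hd hη,
    h.eventually_ballVol_le hd (η := v / (m (ball x 1)).toReal) (by positivity),
    Ioo_mem_nhdsGT (one_pos (α := ℝ))] with r hr1 hr2 hr3
  refine ⟨hr2.trans ?_, hr1⟩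
  rw [div_mul_eq_mul_div, div_le_iff₀ hM]
  have : (m (ball x r)).toReal ≤ (m (ball x 1)).toReal :=
    ENNReal.toReal_mono (h.ball_lt_top x 1).ne (measure_mono (ball_subset_ball hr3.2.le))
  gcongr

variable [BorelSpace X] [ProperSpace X]

/-- A volume minimizer cannot be filled in starting from a point while its complement is filled in
starting from a ball that does not contain this point. -/
theorem false_of_ballFilling (h : LocalPI m N k lam CP)
    (hsph : ∀ (x : X) (r : ℝ), 0 < r → m (sphere x r) = 0) {E : Set X} (hmin : IsVolumeMin m E)
    {x y : X} {a R₁ C₁ R₂ C₂ : ℝ} (hx : BallFilling m Eᶜ x a R₁ C₁)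
    (hy : BallFilling m E y 0 R₂ C₂) (hd : a < dist x y) : False := by
  have hN := h.one_le_N
  have hN0 : N ≠ 0 := by omega
  have hNr : (1 : ℝ) ≤ N := by exact_mod_cast hN
  have hC₁ := hx.C_nonneg
  have hC₂ := hy.C_nonneg
  have ha := hx.nonneg
  have hK : 0 < 2 ^ (N * k + N + 3) * CP := mul_pos (by positivity) h.CP_pos
  set K := 2 ^ (N * k + N + 3) * CP with hKdef
  obtain ⟨δ, hδ0, hδ1, hδ2, hδ3⟩ : ∃ δ > 0, δ < R₁ - a ∧ δ < R₂ ∧ 2 * δ < dist x y - a := by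
    have h1 : 0 < min (R₁ - a) (min R₂ ((dist x y - a) / 2)) :=
      lt_min (sub_pos.2 hx.lt) (lt_min hy.lt (by linarith))
    obtain ⟨δ, h2, h3⟩ := exists_between h1
    simp only [lt_min_iff] at h3
    exact ⟨δ, h2, h3.1, h3.2.1, by linarith⟩
  have hxpos : 0 < ballVol m E x (a + δ) := by
    have := hx.pos (a + δ) (by linarith)
    rw [compl_compl, ← ofReal_ballVol (h.ball_lt_top x)] at this
    exact ENNReal.ofReal_pos.1 this
  have hypos : ∀ s, 0 < s → 0 < ballVol m Eᶜ y s := by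
    intro s hs
    have := hy.pos s hs
    rw [← ofReal_ballVol (h.ball_lt_top y)] at this
    exact ENNReal.ofReal_pos.1 this
  obtain ⟨ε, hε0, hε2, hεC₁, hεC₂, hεN⟩ : ∃ ε : ℝ, 0 < ε ∧ ε ≤ 1 / 2 ∧ 16 * K * C₁ * ε ≤ 1 ∧
      16 * K * C₂ * ε ≤ 1 ∧ 64 * K * N * ε < 1 := by
    have hA : 0 ≤ K * C₁ := by positivity
    have hB : 0 ≤ K * C₂ := by positivity
    have hD : 0 < K * N := by positivity
    refine ⟨1 / (2 + 16 * (K * C₁) + 16 * (K * C₂) + 64 * (K * N)), by positivity, ?_, ?_, ?_, ?_⟩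
    · exact one_div_le_one_div_of_le (by norm_num) (by linarith)
    · rw [mul_one_div, div_le_one (by positivity)]
      linarith
    · rw [mul_one_div, div_le_one (by positivity)]
      linarith
    · rw [mul_one_div, div_lt_one (by positivity)]
      linarith
  have hdx := hx.density
  rw [compl_compl] at hdx
  obtain ⟨r₀, ⟨hxy, hxε⟩, ⟨hyx, hyε⟩, hr₀0, hr₀⟩ :=
    ((h.eventually_ballVol_le' hdx (pow_pos hε0 N) (hypos δ hδ0)).and
    ((h.eventually_ballVol_le' hy.density (pow_pos hε0 N) hxpos).and
      (Ioo_mem_nhdsGT (lt_min hδ0 (one_half_pos (α := ℝ)))))).exists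
  obtain ⟨hr₀δ, hr₀1⟩ := lt_min_iff.1 hr₀
  have hσ : ∀ z : X, ∃ σ : ℝ, 0 < σ ∧ σ ^ N = (m (ball z r₀)).toReal := fun z => by
    have hM : 0 < (m (ball z r₀)).toReal :=
      ENNReal.toReal_pos (h.ball_pos z r₀ hr₀0).ne' (h.ball_lt_top z r₀).ne
    exact ⟨_, Real.rpow_pos_of_pos hM _, Real.rpow_inv_natCast_pow hM.le hN0⟩
  obtain ⟨σ₁, hσ₁, hσ₁e⟩ := hσ x
  obtain ⟨σ₂, hσ₂, hσ₂e⟩ := hσ y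
  rw [← hσ₁e, ← mul_pow] at hxε
  rw [← hσ₂e, ← mul_pow] at hyε
  have hσm : ∀ (z : X) (σ : ℝ), σ ^ N = (m (ball z r₀)).toReal →
      ENNReal.ofReal (σ ^ N) ≤ m (ball z r₀) := fun z σ hz => by
    rw [hz, ENNReal.ofReal_toReal (h.ball_lt_top z r₀).ne]
  have he : ∀ σ, 0 < σ → ε * σ < σ / (8 * K * r₀) / (2 * N) * ((r₀ - r₀ / 2) / 2) := by
    intro σ hσ
    have : σ / (8 * K * r₀) / (2 * N) * ((r₀ - r₀ / 2) / 2) = σ / (64 * K * N) := by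
      field_simp
      norm_num
    rw [this, lt_div_iff₀ (by positivity)]
    nlinarith
  have hmax := max_nonpos_of_growth (v := ballVol m E x) (w := ballVol m Eᶜ y) (a := r₀ / 2)
    (b := r₀) (g₁ := σ₁ / (8 * K * r₀)) (g₂ := σ₂ / (8 * K * r₀)) (e₁ := ε * σ₁) (e₂ := ε * σ₂)
    hN (by linarith) (by positivity) (by positivity) ((ballVol_mono (h.ball_lt_top x)).monotoneOn _)
    ((ballVol_mono (h.ball_lt_top y)).monotoneOn _)
    (h.ballVol_continuousOn hsph hmin.measurableSet x (by linarith))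
    (h.ballVol_continuousOn hsph hmin.measurableSet.compl y (by linarith))
    (fun r hr s hs hrs hle => h.growth_of_ballFilling hsph hmin hy (r₁ := a + δ) (r₂ := δ)
      (by linarith) hδ2 hr₀0 hr₀1.le (by linarith) hr₀δ.le hσ₁ hε2 hεC₂ hε0.le (hσm x σ₁ hσ₁e)
      hxε hxy hr hs hrs hle)
    (fun r hr s hs hrs hle => h.growth_of_ballFilling hsph hmin.compl hx (r₁ := δ) (r₂ := a + δ)
      (by rw [dist_comm]; linarith) (by linarith) hr₀0 hr₀1.le hr₀δ.le (by linarith) hσ₂ hε2 hεC₁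
      hε0.le (hσm y σ₂ hσ₂e) hyε (by rwa [compl_compl]) hr hs hrs (by rwa [compl_compl]))
    (by positivity) (by positivity) (he σ₁ hσ₁) (he σ₂ hσ₂) hxε hyε
  exact (hypos (r₀ / 2) (by linarith)).not_ge ((le_max_right _ _).trans hmax)

/-- Volume minimizers have interior points up to null sets. -/
theorem exists_measure_compl_inter_ball_eq_zero [PreconnectedSpace X] (h : LocalPI m N k lam CP)
    (hsph : ∀ (x : X) (r : ℝ), 0 < r → m (sphere x r) = 0) (hdef : DeformationProperty m)
    {E : Set X} (hmin : IsVolumeMin m E) (hE0 : m E ≠ 0) (hEc : m Eᶜ ≠ 0) :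
    ∃ (y : X) (r : ℝ), 0 < r ∧ m (Eᶜ ∩ ball y r) = 0 := by
  by_contra hI
  obtain ⟨x, a, R₁, C₁, hx⟩ := h.exists_ballFilling hsph hdef hmin.compl.measurableSet
    hmin.compl.per_ne_top hEc (by rwa [compl_compl])
  have hnull := hx.closedBall_eq_zero
  rw [compl_compl] at hnull
  have hE' : m (E \ closedBall x a) ≠ 0 := by
    rwa [measure_sdiff_null' hnull]
  obtain ⟨y, ⟨hyE, hyx⟩, hy⟩ := ((frequently_ae_mem_iff.2 hE').and_eventually
    (h.ae_tendsto_density hsph hmin.measurableSet)).exists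
  obtain ⟨R₂, C₂, hf⟩ := h.exists_ballFilling_of_density hdef hmin.measurableSet hmin.per_ne_top
    hI hyE (hy hyE)
  refine h.false_of_ballFilling hsph hmin hx hf ?_
  rwa [mem_closedBall', not_le] at hyx

end LocalPI

namespace LocalPI
variable [MetricSpace X] [MeasurableSpace X] [BorelSpace X] [ProperSpace X] {m : Measure X}
  {N k : ℕ} {lam CP : ℝ}

/-- A volume minimizer of finite volume that can be filled in near `y` has volume decaying fast
away from `y`: cut off the part outside a large ball and make up for it at `y`. -/
theorem decay_of_ballFilling (h : LocalPI m N k lam CP)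
    (hsph : ∀ (x : X) (r : ℝ), 0 < r → m (sphere x r) = 0) {E : Set X} (hmin : IsVolumeMin m E)
    (hfin : m E ≠ ∞) {y : X} {a R C R' σ ε : ℝ} (hf : BallFilling m E y a R C) (ha : 0 < a)
    (haR' : a ≤ R') (hR' : R' < R) (hσ : 0 < σ)
    (hσm : ∀ z : X, ENNReal.ofReal (σ ^ N) ≤ m (ball z 1)) (hε : ε ≤ 1 / 2)
    (hεC : 4 * (2 ^ (N * k + N + 3) * CP) * C * ε ≤ a) {r s : ℝ} (hr : R' < r)
    (hs : 0 < s) (hrs : (m E).toReal - ballVol m E y r = s ^ N) (hsε : s ≤ ε * σ)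
    (hsy : s ^ N ≤ ballVol m Eᶜ y R') :
    ∀ᶠ t in 𝓝[>] (0 : ℝ), σ / (4 * (2 ^ (N * k + N + 3) * CP)) * s ^ (N - 1) * t ≤
      ballVol m E y (r + t) - ballVol m E y r := by
  have hN := h.one_le_N
  have hN0 : N ≠ 0 := by omega
  have hK : 0 < 2 ^ (N * k + N + 3) * CP := mul_pos (by positivity) h.CP_pos
  set K := 2 ^ (N * k + N + 3) * CP with hKdef
  have hE := hmin.measurableSet
  have hr0 : 0 < r := by linarith
  have hC := hf.C_nonneg
  have hzero : ballVol m Eᶜ y a = 0 := by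
    rw [ballVol, ← measure_inter_closedBall_eq_ball hsph _ _ ha, hf.closedBall_eq_zero, toReal_zero]
  obtain ⟨s', ⟨hs'1, hs'2⟩, hs'⟩ := intermediate_value_Icc haR'
    (h.ballVol_continuousOn hsph hE.compl y ha) ⟨hzero.trans_le (pow_nonneg hs.le N), hsy⟩
  have hs'0 : 0 < s' := ha.trans_le hs'1
  have hmy : m (Eᶜ ∩ ball y s') = ENNReal.ofReal (s ^ N) := by
    rw [← ofReal_ballVol (h.ball_lt_top y), hs']
  have hmx : m (E \ closedBall y r) = ENNReal.ofReal (s ^ N) := by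
    have h1 : m (E ∩ closedBall y r) + m (E \ closedBall y r) = m E :=
      measure_inter_add_sdiff _ measurableSet_closedBall
    rw [measure_inter_closedBall_eq_ball hsph _ _ hr0, ← ofReal_ballVol (h.ball_lt_top y)] at h1
    rw [← hrs, ENNReal.ofReal_sub _ (ballVol_nonneg r), ENNReal.ofReal_toReal hfin, ← h1,
      ENNReal.add_sub_cancel_left ofReal_ne_top]
  have hsq : s ^ N = s ^ (N - 1) * s := by
    rw [← pow_succ, Nat.sub_add_cancel hN]
  have hq : 0 < s ^ (N - 1) := by positivity
  set q := s ^ (N - 1)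
  have hsub : ball y s' ⊆ closedBall y r :=
    (ball_subset_ball (by linarith)).trans ball_subset_closedBall
  have hBeq : (E ∪ ball y s') \ closedBall y r = E \ closedBall y r := by
    ext z
    simp only [Set.mem_sdiff, mem_union]
    have := @hsub z
    tauto
  have hB' : MeasurableSet ((E ∪ ball y s') ∩ closedBall y r) :=
    (hE.union measurableSet_ball).inter measurableSet_closedBall
  have hannulus : ∀ t : ℝ, (E ∪ ball y s') ∩ {z | r ≤ dist z y ∧ dist z y ≤ r + t} ⊆ E := by
    rintro t z ⟨h1 | h1, h2⟩
    · exact h1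
    · exact absurd (mem_ball.1 h1) (by linarith [h2.1])
  have hperA : Per m (E ∪ ball y s') univ ≤
      Per m E univ + ENNReal.ofReal (C * s ^ N / a) := by
    refine (hf.per_le s' hs'0 (hs'2.trans_lt hR')).trans ?_
    rw [add_comm]
    gcongr
    rw [hmy, ← ENNReal.ofReal_mul hC, ← ENNReal.ofReal_div_of_pos hs'0]
    exact ENNReal.ofReal_le_ofReal (by gcongr)
  have hperB : Per m E univ ≤ Per m ((E ∪ ball y s') ∩ closedBall y r) univ := by
    refine hmin.per_le _ hB' ?_
    have e1 : ((E ∪ ball y s') ∩ closedBall y r) \ E = Eᶜ ∩ ball y s' := by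
      ext z
      simp only [Set.mem_sdiff, mem_union, mem_inter_iff, mem_compl_iff]
      have := @hsub z
      tauto
    have e2 : E \ ((E ∪ ball y s') ∩ closedBall y r) = E \ closedBall y r := by
      ext z
      simp only [Set.mem_sdiff, mem_union, mem_inter_iff]
      tauto
    rw [e1, e2, hmx, hmy]
  refine h.eventually_le_ballVol_sub hsph hr0 (hE.union measurableSet_ball) hE
    (Or.inr ⟨rfl, rfl⟩) (.of_forall hannulus) (l := 1) (s := s) (σ := σ)
    (D := σ / (4 * K) * q) (Q := C * s ^ N / a)
    hmin.per_ne_top (by positivity) (by positivity) hperA hperB one_pos le_rfl hs hσ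
    (by rw [hBeq, hmx]) ?_ (fun z _ => hσm z) ?_
  · have h1 : s ^ N ≤ (σ / 2) ^ N := pow_le_pow_left₀ hs.le (by nlinarith) N
    have h2 : (2 : ℝ) ≤ 2 ^ N := by
      calc (2 : ℝ) = 2 ^ 1 := (pow_one _).symm
        _ ≤ 2 ^ N := pow_le_pow_right₀ (by norm_num) hN
    rw [div_pow, le_div_iff₀ (by positivity)] at h1
    have : 0 < s ^ N := by positivity
    nlinarith
  · have e : K * 1 * (C * s ^ N / a + 2 * (σ / (4 * K) * q)) =
        K * C * q * s / a + σ * q / 2 := by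
      rw [hsq]
      field_simp
      ring
    rw [e]
    have h1 : K * C * q * s / a ≤ K * C * q * (ε * σ) / a := by gcongr
    have h2 : K * C * q * (ε * σ) / a ≤ σ * q / 4 := by
      rw [div_le_iff₀ ha]
      have : 4 * K * C * ε * (σ * q) ≤ a * (σ * q) := by gcongr
      linarith
    have : 0 < σ * q := by positivity
    linarith

theorem exists_measure_diff_ball_eq_zero (h : LocalPI m N k lam CP)
    (hsph : ∀ (x : X) (r : ℝ), 0 < r → m (sphere x r) = 0) (hball : 0 < ⨅ x : X, m (ball x 1))
    {E : Set X} (hmin : IsVolumeMin m E) (hfin : m E ≠ ∞) {y : X} {a R C : ℝ}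
    (hf : BallFilling m E y a R C) (ha : 0 < a) : ∃ T : ℝ, m (E \ ball y T) = 0 := by
  have hN := h.one_le_N
  have hN0 : N ≠ 0 := by omega
  have hNr : (0 : ℝ) < N := by positivity
  have hC := hf.C_nonneg
  have hK : 0 < 2 ^ (N * k + N + 3) * CP := mul_pos (by positivity) h.CP_pos
  obtain ⟨R', haR', hR'⟩ := exists_between hf.lt
  have hypos : 0 < ballVol m Eᶜ y R' := by
    have := hf.pos R' haR'
    rw [← ofReal_ballVol (h.ball_lt_top y)] at this
    exact ENNReal.ofReal_pos.1 this
  obtain ⟨σ, hσ, hσm⟩ : ∃ σ : ℝ, 0 < σ ∧ ∀ z : X, ENNReal.ofReal (σ ^ N) ≤ m (ball z 1) := by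
    have hM : 0 < (⨅ x : X, m (ball x 1)).toReal :=
      ENNReal.toReal_pos hball.ne' (ne_top_of_le_ne_top (h.ball_lt_top y 1).ne (iInf_le _ y))
    refine ⟨_, Real.rpow_pos_of_pos hM (N : ℝ)⁻¹, fun z => ?_⟩
    rw [Real.rpow_inv_natCast_pow hM.le hN0]
    exact ENNReal.ofReal_toReal_le.trans (iInf_le _ z)
  obtain ⟨ε, hε0, hε2, hεC⟩ : ∃ ε : ℝ, 0 < ε ∧ ε ≤ 1 / 2 ∧
      4 * (2 ^ (N * k + N + 3) * CP) * C * ε ≤ a := by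
    set K := 2 ^ (N * k + N + 3) * CP
    have hA : 0 ≤ K * C := by positivity
    refine ⟨a / (2 * a + 4 * (K * C)), by positivity, ?_, ?_⟩
    · rw [div_le_iff₀ (by positivity)]
      linarith
    · rw [mul_div_assoc', div_le_iff₀ (by positivity)]
      nlinarith
  have hlim : Tendsto (fun ρ => (m E).toReal - ballVol m E y ρ) atTop (𝓝 0) := by
    have h1 : Tendsto (fun ρ : ℝ => m (E ∩ ball y ρ)) atTop (𝓝 (m (⋃ ρ : ℝ, E ∩ ball y ρ))) :=
      tendsto_measure_iUnion_atTop fun _ _ hst =>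
        inter_subset_inter_right _ (ball_subset_ball hst)
    have h2 : ⋃ ρ : ℝ, E ∩ ball y ρ = E := by
      rw [← inter_iUnion]
      exact inter_eq_left.2 fun z _ => mem_iUnion.2 ⟨dist z y + 1, mem_ball.2 (by linarith)⟩
    rw [h2] at h1
    have h3 := ((ENNReal.tendsto_toReal hfin).comp h1).const_sub (m E).toReal
    rwa [sub_self] at h3
  obtain ⟨ρ₀, ⟨hρ1, hρ2⟩, hρ3⟩ := (((hlim.eventually_le_const hypos).and
    (hlim.eventually_le_const (show 0 < (ε * σ) ^ N by positivity))).and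
    (eventually_gt_atTop R')).exists
  have hmono := ballVol_mono (A := E) (h.ball_lt_top y)
  set g := σ / (4 * (2 ^ (N * k + N + 3) * CP)) with hg
  have hg0 : 0 < g := by positivity
  set b := ρ₀ + 2 * N / g * (ε * σ) with hb
  have hρb : ρ₀ ≤ b := le_add_of_nonneg_right (by positivity)
  have hnot := not_pos_of_decay (f := fun ρ => (m E).toReal - ballVol m E y ρ) (a := ρ₀) (b := b)
    (g := g) hN hρb hg0
    (continuousOn_const.sub (h.ballVol_continuousOn hsph hmin.measurableSet y (by linarith)))
    (by
      refine hρ2.trans_eq ?_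
      congr 1
      rw [hb]
      field_simp
      ring)
    (by
      intro r hr s hs hrs
      have hle : s ^ N ≤ (m E).toReal - ballVol m E y ρ₀ :=
        hrs ▸ sub_le_sub_left (hmono hr.1) _
      have hsε : s ≤ ε * σ :=
        (pow_le_pow_iff_left₀ hs.le (by positivity) hN0).1 (hle.trans hρ2)
      filter_upwards [h.decay_of_ballFilling hsph hmin hfin hf ha haR'.le hR' hσ hσm hε2 hεC
        (hρ3.trans_le hr.1) hs hrs hsε (hle.trans hρ1)] with t ht
      linarith)
  push Not at hnot
  obtain ⟨T, -, hT⟩ := hnot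
  refine ⟨T, ?_⟩
  have h1 : m (E ∩ ball y T) + m (E \ ball y T) = m E :=
    measure_inter_add_sdiff _ measurableSet_ball
  have h2 : m E ≤ m (E ∩ ball y T) := by
    rw [← ofReal_ballVol (h.ball_lt_top y), ← ENNReal.ofReal_toReal hfin]
    exact ENNReal.ofReal_le_ofReal (by linarith)
  have h3 : m (E ∩ ball y T) ≠ ∞ := ne_top_of_le_ne_top hfin (measure_mono inter_subset_left)
  refine le_antisymm ((ENNReal.add_le_add_iff_left h3).1 ?_) zero_le
  rw [h1, add_zero]
  exact h2

end LocalPI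

theorem isBounded_essInt [MetricSpace X] [MeasurableSpace X] {m : Measure X} {E : Set X} {y : X} {T : ℝ}
    (hT : m (E \ ball y T) = 0) : IsBounded (essInt m E) := by
  refine isBounded_closedBall.subset (t := closedBall y T) fun z hz => ?_
  by_contra hzT
  rw [mem_closedBall, not_le] at hzT
  have h0 : Tendsto (fun r => m (E ∩ ball z r) / m (ball z r)) (𝓝[>] 0) (𝓝 0) := by
    refine tendsto_const_nhds.congr' ?_
    filter_upwards [Ioo_mem_nhdsGT (sub_pos.2 hzT)] with r hr
    have hsub : E ∩ ball z r ⊆ E \ ball y T := by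
      rintro w ⟨hwE, hw⟩
      refine ⟨hwE, fun hwy => ?_⟩
      rw [mem_ball] at hw hwy
      linarith [hr.2, dist_triangle_left z y w]
    rw [measure_mono_null hsub hT, ENNReal.zero_div]
  exact zero_ne_one (tendsto_nhds_unique h0 hz)

/-- A noncollapsed space of finite volume is bounded. -/
theorem exists_ball_eq_univ [MetricSpace X] [MeasurableSpace X] [BorelSpace X] {m : Measure X}
    (hball : 0 < ⨅ x : X, m (ball x 1)) (hfin : m univ ≠ ∞) (y : X) :
    ∃ T, ball y T = univ := by
  have h1 : Tendsto (fun n : ℕ => m (ball y n)ᶜ) atTop (𝓝 (m (⋂ n : ℕ, (ball y n)ᶜ))) :=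
    tendsto_measure_iInter_atTop (fun _ => measurableSet_ball.compl.nullMeasurableSet)
      (fun _ _ hst => compl_subset_compl.2 (ball_subset_ball (by exact_mod_cast hst)))
      ⟨0, ne_top_of_le_ne_top hfin (measure_mono (subset_univ _))⟩
  have h2 : ⋂ n : ℕ, (ball y (n : ℝ))ᶜ = ∅ := by
    rw [← compl_iUnion, iUnion_ball_nat, compl_univ]
  rw [h2, measure_empty] at h1
  obtain ⟨n, hn⟩ := (h1.eventually_lt_const hball).exists
  refine ⟨n + 1, eq_univ_of_forall fun z => ?_⟩
  by_contra hz
  rw [mem_ball, not_lt] at hz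
  refine hn.not_ge ((iInf_le _ z).trans (measure_mono fun w hw hwy => ?_))
  rw [mem_ball] at hw hwy
  linarith [dist_triangle_left z y w]

theorem IsIsoperimetricSet.exists_measure_diff_ball_eq_zero [MetricSpace X] [CompleteSpace X]
    [MeasurableSpace X] [BorelSpace X] {m : Measure X}
    (hbf : BoundedlyFinite m) (hPI : IsPIspace m) (hlen : IsLengthSpace X)
    (hdef : DeformationProperty m) (hball : 0 < ⨅ x : X, m (ball x 1)) {E : Set X}
    (hE : IsIsoperimetricSet m E) : ∃ (y : X) (T : ℝ), m (E \ ball y T) = 0 := by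
  obtain ⟨N, k, lam, CP, h⟩ := exists_localPI hbf hPI hball
  have := h.properSpace hball
  have := h.isUnifLocDoublingMeasure
  have := h.isLocallyFiniteMeasure
  have := hlen.preconnectedSpace
  have hsph : ∀ (x : X) (r : ℝ), 0 < r → m (sphere x r) = 0 :=
    fun x r hr => hlen.measure_sphere_eq_zero m x hr
  have hmin := hE.isVolumeMin
  obtain ⟨hEm, hper, hE0, hEfin, -⟩ := hE
  by_cases hEc : m Eᶜ = 0
  · obtain ⟨y, -⟩ := nonempty_of_measure_ne_zero hE0.ne'
    have hfin : m univ ≠ ∞ := by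
      rw [← measure_add_measure_compl hEm, hEc, add_zero]
      exact hEfin.ne
    obtain ⟨T, hT⟩ := exists_ball_eq_univ hball hfin y
    exact ⟨y, T, by simp [hT]⟩
  · obtain ⟨y, a, R, C, ha, hf⟩ := h.exists_ballFilling_of_interior hsph hdef hEm hper.ne hEc
      (h.exists_measure_compl_inter_ball_eq_zero hsph hdef hmin hE0.ne' hEc)
    exact ⟨y, h.exists_measure_diff_ball_eq_zero hsph hball hmin hEfin.ne hf ha⟩

/-- **Boundedness of isoperimetric sets** (Theorem 1.2): in a length PI space with the
deformation property and with volumes of unit balls uniformly bounded below, the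
essential interior of any isoperimetric set is bounded; in particular every
isoperimetric set has a bounded Borel representative. -/
theorem isoperimetric_sets_are_bounded
    {X : Type*} [MetricSpace X] [CompleteSpace X] [TopologicalSpace.SeparableSpace X]
    [MeasurableSpace X] [BorelSpace X] (m : Measure X)
    (hbf : BoundedlyFinite m) (hPI : IsPIspace m) (hlen : IsLengthSpace X)
    (hdef : DeformationProperty m)
    (hball : 0 < ⨅ x : X, m (Metric.ball x 1))
    (E : Set X) (hE : IsIsoperimetricSet m E) :
    Bornology.IsBounded (essInt m E) ∧
    ∃ F : Set X, MeasurableSet F ∧ Bornology.IsBounded F ∧ m (E ∆ F) = 0 := by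
  obtain ⟨y, T, hT⟩ := hE.exists_measure_diff_ball_eq_zero hbf hPI hlen hdef hball
  refine ⟨isBounded_essInt hT, E ∩ ball y T, hE.1.inter measurableSet_ball,
    isBounded_ball.subset inter_subset_right, ?_⟩
  rwa [Set.symmDiff_def, sdiff_self_inter, Set.sdiff_eq_empty.2 inter_subset_left, union_empty]

end
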